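/- arXiv:2109.05514 — 2 statements merged into one kernel-verified Lean document; each statement's English description precedes it below -/
import Mathlib

section
/- (Theorem 2) For q ∈ {5, 11, 17, 23}, the code L(q) contains exactly 4q+2 (0,1)-codewords of weight q+1, and each of them equals r + 2·1̄ for some row r of H or of −H (reduced mod 3) other than the all-one row of H and its negative, where H = [[I_{q+1} − U_qᵀ, U_q + I_{q+1}], [I_{q+1} + U_qᵀ, U_q − I_{q+1}]]. -/
open Matrix Finset

/-- The Pless matrix `S_q`, with rows and columns indexed by `GF(q) ∪ {∞}`
(`none` playing the role of `∞`), built from the quadratic character of `GF(q)`. -/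
def Smat (F : Type) [Field F] [Fintype F] [DecidableEq F] :
    Matrix (Option F) (Option F) ℤ := fun i j =>
  match i, j with
  | none, none => 0
  | none, some _ => 1
  | some _, none => quadraticChar F (-1)
  | some a, some b => quadraticChar F (a - b)

/-- The matrix `U_q`, obtained from `S_q` by replacing each entry `s_{a,∞}`
(`a ∈ GF(q)`) in the column labeled `∞` by `-1`. -/
def Umat (F : Type) [Field F] [Fintype F] [DecidableEq F] :
    Matrix (Option F) (Option F) ℤ := fun i j =>
  match i, j with
  | some _, none => -1
  | i, j => Smat F i j

/-- The row of the generator matrix `(I | U_q)` of the code `L(q)`,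
reduced modulo 3, indexed by `i : Option F`. -/
def genRowL (F : Type) [Field F] [Fintype F] [DecidableEq F] (i : Option F) :
    (Option F ⊕ Option F) → ZMod 3 := fun j =>
  match j with
  | Sum.inl k => if i = k then 1 else 0
  | Sum.inr k => ((Umat F i k : ℤ) : ZMod 3)

/-- The code `L(q)`: the ternary code of length `2q+2` spanned by the rows of
`(I | U_q)` reduced modulo 3; it is monomially equivalent to the Pless symmetry code. -/
def Lcode (F : Type) [Field F] [Fintype F] [DecidableEq F] :
    Submodule (ZMod 3) ((Option F ⊕ Option F) → ZMod 3) :=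
  Submodule.span (ZMod 3) (Set.range (genRowL F))

/-- The Hadamard matrix `H = [[I − U_qᵀ, U_q + I], [I + U_qᵀ, U_q − I]]`. -/
def Hmat (F : Type) [Field F] [Fintype F] [DecidableEq F] :
    Matrix (Option F ⊕ Option F) (Option F ⊕ Option F) ℤ :=
  Matrix.fromBlocks (1 - (Umat F)ᵀ) (Umat F + 1) (1 + (Umat F)ᵀ) (Umat F - 1)

/-- The vector `r + 2·1̄` over `GF(3)`, where `r` is the row of `H` (if `s = true`)
or of `−H` (if `s = false`) indexed by `i`, reduced modulo 3. -/
def dvec (F : Type) [Field F] [Fintype F] [DecidableEq F]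
    (s : Bool) (i : Option F ⊕ Option F) : (Option F ⊕ Option F) → ZMod 3 := fun j =>
  (if s then 1 else -1) * ((Hmat F i j : ℤ) : ZMod 3) + 2

/-! ### Exhaustive search by truth tables -/

/-- The sum of the coefficients at the positions marked `true`. -/
def dot : List ℕ → List Bool → ℕ
  | c :: cs, b :: bs => bif b then c + dot cs bs else dot cs bs
  | _, _ => 0

/-- The value at the given arguments of a Boolean function whose truth table is written in the
binary digits of a natural number. -/
def evalTable : ℕ → List Bool → Bool
  | g, [] => g % 2 == 1
  | g, b :: bs =>
    evalTable (bif b then g / 2 ^ 2 ^ bs.length else g % 2 ^ 2 ^ bs.length) bs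

/-- The truth tables of `dot cs a % 3 ≠ r` for `r = 0, 1, 2`. -/
def tables : List ℕ → ℕ × ℕ × ℕ
  | [] => (0, 1, 1)
  | c :: cs =>
    let t := tables cs
    let s := 2 ^ 2 ^ cs.length
    match c % 3 with
    | 0 => (t.1 + s * t.1, t.2.1 + s * t.2.1, t.2.2 + s * t.2.2)
    | 1 => (t.1 + s * t.2.2, t.2.1 + s * t.1, t.2.2 + s * t.2.1)
    | _ => (t.1 + s * t.2.1, t.2.1 + s * t.2.2, t.2.2 + s * t.1)

/-- The table of `(r + dot cs a) % 3 ≠ 2`, where `t` is `tables cs`. -/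
def pick (t : ℕ × ℕ × ℕ) (r : ℕ) : ℕ :=
  match r % 3 with
  | 0 => t.2.2
  | 1 => t.2.1
  | _ => t.1

/-- Checks `k` at all arguments where the truth table `g` in `m` variables is true. -/
def allMarked : ℕ → ℕ → (List Bool → Bool) → Bool
  | 0, g, k => bif g % 2 == 0 then true else k []
  | m + 1, g, k => bif g == 0 then true else
      (allMarked m (g % 2 ^ 2 ^ m) fun l => k (false :: l)) &&
      (allMarked m (g / 2 ^ 2 ^ m) fun l => k (true :: l))

/-- Checks `k` at all Boolean lists of length `p`. -/
def allPrefixes : ℕ → (List Bool → Bool) → Bool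
  | 0, k => k []
  | p + 1, k => (allPrefixes p fun l => k (false :: l)) && (allPrefixes p fun l => k (true :: l))

/-- Checks `k` at all Boolean lists `a` of length `p + m` such that `dot c a % 3 ≠ 2` for all
`c ∈ C`: the first `p` entries are enumerated, the others are treated by truth tables. -/
def search (C : List (List ℕ)) (p m : ℕ) (k : List Bool → Bool) : Bool :=
  allPrefixes p fun pre =>
    allMarked m
      ((C.map fun c => (c.take p, tables (c.drop p))).foldr
        (fun x g => Nat.land (pick x.2 (dot x.1 pre)) g) (2 ^ 2 ^ m - 1))
      fun suf => k (pre ++ suf)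

theorem evalTable_zero (bs : List Bool) : evalTable 0 bs = false := by
  induction bs with
  | nil => rfl
  | cons b bs ih => cases b <;> simp [evalTable, ih]

theorem evalTable_land (g h : ℕ) (bs : List Bool) :
    evalTable (Nat.land g h) bs = (evalTable g bs && evalTable h bs) := by
  change evalTable (g &&& h) bs = _
  induction bs generalizing g h with
  | nil =>
    have := Nat.testBit_and g h 0
    simp only [Nat.testBit_zero] at this
    simpa only [evalTable, Bool.beq_eq_decide_eq] using this
  | cons b bs ih =>
    cases b
    · simp [evalTable, Nat.and_mod_two_pow, ih]
    · simp [evalTable, Nat.and_div_two_pow, ih]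

theorem evalTable_cons {lo : ℕ} (hi : ℕ) (b : Bool) (bs : List Bool)
    (h : lo < 2 ^ 2 ^ bs.length) :
    evalTable (lo + 2 ^ 2 ^ bs.length * hi) (b :: bs) = evalTable (bif b then hi else lo) bs := by
  cases b
  · simp [evalTable, Nat.mod_eq_of_lt h]
  · simp [evalTable, Nat.add_mul_div_left, Nat.div_eq_of_lt h]

theorem add_two_pow_mul_lt {m lo hi : ℕ} (hlo : lo < 2 ^ 2 ^ m) (hhi : hi < 2 ^ 2 ^ m) :
    lo + 2 ^ 2 ^ m * hi < 2 ^ 2 ^ (m + 1) := by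
  rw [pow_succ 2 m, pow_mul]
  nlinarith

theorem evalTable_ones (bs : List Bool) : evalTable (2 ^ 2 ^ bs.length - 1) bs = true := by
  induction bs with
  | nil => rfl
  | cons b bs ih =>
    have h : 2 ^ 2 ^ (b :: bs).length - 1 =
        (2 ^ 2 ^ bs.length - 1) + 2 ^ 2 ^ bs.length * (2 ^ 2 ^ bs.length - 1) := by
      obtain ⟨s, hs⟩ : ∃ s, 2 ^ 2 ^ bs.length = s + 1 :=
        Nat.exists_eq_succ_of_ne_zero (by positivity)
      rw [List.length_cons, pow_succ 2 bs.length, pow_mul, hs, Nat.add_sub_cancel]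
      have : (s + 1) ^ 2 = s + (s + 1) * s + 1 := by ring
      omega
    rw [h, evalTable_cons _ _ _ (Nat.sub_lt (by positivity) one_pos), Bool.cond_self, ih]

theorem tables_lt (cs : List ℕ) : (tables cs).1 < 2 ^ 2 ^ cs.length ∧
    (tables cs).2.1 < 2 ^ 2 ^ cs.length ∧ (tables cs).2.2 < 2 ^ 2 ^ cs.length := by
  induction cs with
  | nil => decide
  | cons c cs ih =>
    obtain ⟨h0, h1, h2⟩ := ih
    simp only [tables, List.length_cons]
    split <;> refine ⟨?_, ?_, ?_⟩ <;> apply add_two_pow_mul_lt <;> assumption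

theorem evalTable_tables (cs : List ℕ) (bs : List Bool) (h : bs.length = cs.length) :
    (evalTable (tables cs).1 bs = true ↔ dot cs bs % 3 ≠ 0) ∧
    (evalTable (tables cs).2.1 bs = true ↔ dot cs bs % 3 ≠ 1) ∧
    (evalTable (tables cs).2.2 bs = true ↔ dot cs bs % 3 ≠ 2) := by
  induction cs generalizing bs with
  | nil =>
    obtain rfl : bs = [] := List.length_eq_zero_iff.1 h
    decide
  | cons c cs ih =>
    obtain _ | ⟨b, bs⟩ := bs
    · simp at h
    have h' : bs.length = cs.length := by simpa using h
    obtain ⟨h0, h1, h2⟩ := tables_lt cs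
    obtain ⟨e0, e1, e2⟩ := ih bs h'
    rw [← h'] at h0 h1 h2
    have hc : c % 3 = 0 ∨ c % 3 = 1 ∨ c % 3 = 2 := by omega
    rcases hc with hc | hc | hc <;> simp only [tables, hc, ← h', dot] <;>
      rw [evalTable_cons _ _ _ h0, evalTable_cons _ _ _ h1, evalTable_cons _ _ _ h2] <;>
      cases b <;> simp only [cond_true, cond_false, e0, e1, e2] <;>
      refine ⟨?_, ?_, ?_⟩ <;> first | trivial | omega

theorem evalTable_pick (cs : List ℕ) (bs : List Bool) (h : bs.length = cs.length) (r : ℕ) :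
    evalTable (pick (tables cs) r) bs = true ↔ (r + dot cs bs) % 3 ≠ 2 := by
  obtain ⟨e0, e1, e2⟩ := evalTable_tables cs bs h
  have hr : r % 3 = 0 ∨ r % 3 = 1 ∨ r % 3 = 2 := by omega
  rcases hr with hr | hr | hr <;> simp only [pick, hr, e0, e1, e2] <;> omega

theorem dot_append (cs cs' : List ℕ) (bs bs' : List Bool) (h : bs.length = cs.length) :
    dot (cs ++ cs') (bs ++ bs') = dot cs bs + dot cs' bs' := by
  induction cs generalizing bs with
  | nil =>
    obtain rfl : bs = [] := List.length_eq_zero_iff.1 h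
    simp [dot]
  | cons c cs ih =>
    obtain _ | ⟨b, bs⟩ := bs
    · simp at h
    have := ih bs (by simpa using h)
    cases b <;> simp [dot, this, add_assoc]

theorem allMarked_spec {m g : ℕ} {k : List Bool → Bool} (h : allMarked m g k = true)
    {bs : List Bool} (hbs : bs.length = m) (hg : evalTable g bs = true) : k bs = true := by
  induction m generalizing g k bs with
  | zero =>
    obtain rfl : bs = [] := List.length_eq_zero_iff.1 hbs
    simp only [evalTable, beq_iff_eq] at hg
    simpa [allMarked, hg] using h
  | succ m ih =>
    obtain _ | ⟨b, bs⟩ := bs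
    · simp at hbs
    have hbs' : bs.length = m := by simpa using hbs
    by_cases h0 : g = 0
    · simp [h0, evalTable_zero] at hg
    have h0' : (g == 0) = false := by simpa using h0
    simp only [allMarked, h0', cond_false, Bool.and_eq_true] at h
    subst hbs'
    cases b
    · exact ih h.1 rfl (by simpa [evalTable] using hg)
    · exact ih h.2 rfl (by simpa [evalTable] using hg)

theorem allPrefixes_spec {p : ℕ} {k : List Bool → Bool} (h : allPrefixes p k = true)
    {bs : List Bool} (hbs : bs.length = p) : k bs = true := by
  induction p generalizing k bs with
  | zero =>
    obtain rfl : bs = [] := List.length_eq_zero_iff.1 hbs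
    exact h
  | succ p ih =>
    obtain _ | ⟨b, bs⟩ := bs
    · simp at hbs
    have hbs' : bs.length = p := by simpa using hbs
    simp only [allPrefixes, Bool.and_eq_true] at h
    cases b
    · exact ih h.1 hbs'
    · exact ih h.2 hbs'

theorem search_spec {C : List (List ℕ)} {p m : ℕ} {k : List Bool → Bool}
    (h : search C p m k = true) {a : List Bool} (ha : a.length = p + m)
    (hC : ∀ c ∈ C, c.length = p + m) (hdot : ∀ c ∈ C, dot c a % 3 ≠ 2) : k a = true := by
  have hpre : (a.take p).length = p := by simp [ha]
  have hsuf : (a.drop p).length = m := by simp [ha]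
  rw [← List.take_append_drop p a]
  refine allMarked_spec (allPrefixes_spec h hpre) hsuf ?_
  clear h
  induction C with
  | nil => simpa [hsuf] using evalTable_ones (a.drop p)
  | cons c C ih =>
    have hc := hC c (by simp)
    rw [List.map_cons, List.foldr_cons, evalTable_land,
      ih (fun c hc => hC c (by simp [hc])) (fun c hc => hdot c (by simp [hc])), Bool.and_true,
      evalTable_pick _ _ (by simp [ha, hc]), ← dot_append _ _ _ _ (by simp [ha, hc]),
      List.take_append_drop, List.take_append_drop]
    exact hdot c (by simp)

/-! ### The code in coordinates -/

/-- The quadratic character of `ZMod q`, with `-1` represented by `2`. -/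
def charNat (q x : ℕ) : ℕ :=
  bif x % q == 0 then 0 else bif (List.range q).any (fun y => y * y % q == x % q) then 1 else 2

/-- The entries of `Umat` modulo 3, where the row or column `0` is the one labeled `∞` and
`i + 1` belongs to the field element `i`. -/
def entryU (q : ℕ) : ℕ → ℕ → ℕ
  | 0, 0 => 0
  | 0, _ + 1 => 1
  | _ + 1, 0 => 2
  | i + 1, j + 1 => charNat q (i + (q - j))

/-- The list of columns of `Umat` modulo 3. -/
def columnsU (q : ℕ) : List (List ℕ) :=
  (List.range (q + 1)).map fun j => (List.range (q + 1)).map fun i => entryU q i j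

/-- The entry in column `inl k` of the vector `dvec`. A triple `(s, t, i)` stands for the sign `s`
and the row `inr i` (if `t = true`) or `inl i` (if `t = false`). -/
def leftEntry (q : ℕ) (x : Bool × Bool × ℕ) (k : ℕ) : ℕ :=
  ((bif x.1 then 1 else 2) * ((bif x.2.2 == k then 1 else 0) +
    (bif x.2.1 then 1 else 2) * entryU q k x.2.2) + 2) % 3

/-- The entry in column `inr k` of the vector `dvec`. -/
def rightEntry (q : ℕ) (x : Bool × Bool × ℕ) (k : ℕ) : ℕ :=
  ((bif x.1 then 1 else 2) * (entryU q x.2.2 k +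
    (bif x.2.1 then 2 else 1) * (bif x.2.2 == k then 1 else 0)) + 2) % 3

/-- The indices of all vectors `dvec`, except those of the all-one row and its negative. -/
def dvecIndices (q : ℕ) : List (Bool × Bool × ℕ) :=
  [false, true].flatMap fun s => ((List.range (q + 1)).map fun i => (s, true, i)) ++
    ((List.range q).map fun i => (s, false, i + 1))

/-- The left half of a vector `dvec`, assuming its entries are `0` and `1`. -/
def leftHalf (q : ℕ) (x : Bool × Bool × ℕ) : List Bool :=
  (List.range (q + 1)).map fun k => leftEntry q x k == 1

/-- The weight of the `(0,1)`-codeword with left half `a`. -/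
def weight (q : ℕ) (a : List Bool) : ℕ :=
  a.foldr (fun b n => bif b then n.succ else n)
    ((columnsU q).foldr (fun c n => Nat.add (Nat.mod (dot c a) 3) n) 0)

/-- Each vector `dvec` is a `(0,1)`-codeword of weight `q + 1`. -/
def checkDvec (q : ℕ) : Bool :=
  (dvecIndices q).all fun x =>
    weight q (leftHalf q x) == q + 1 &&
    (List.range (q + 1)).all fun k =>
      leftEntry q x k != 2 && rightEntry q x k != 2 &&
      dot ((List.range (q + 1)).map fun i => entryU q i k) (leftHalf q x) % 3 == rightEntry q x k

/-- Each `(0,1)`-codeword of weight `q + 1` is a vector `dvec`. -/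
def checkSearch (q p : ℕ) : Bool :=
  search (columnsU q) p (q + 1 - p) fun a =>
    bif weight q a == q + 1 then ((dvecIndices q).map (leftHalf q)).elem a else true

theorem dot_map {ι : Type*} (l : List ι) (f : ι → ℕ) (g : ι → Bool) :
    dot (l.map f) (l.map g) = (l.map fun i => bif g i then f i else 0).sum := by
  induction l with
  | nil => rfl
  | cons x l ih => cases h : g x <;> simp [dot, h, ih]

theorem sum_map_range_eq {M : Type*} [AddCommMonoid M] (n : ℕ) (f : ℕ → M) :
    ((List.range n).map f).sum = ∑ i ∈ Finset.range n, f i := by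
  simp [Finset.sum_eq_multiset_sum, Finset.range, Multiset.range]

theorem dot_map_range (n : ℕ) (f : ℕ → ℕ) (g : ℕ → Bool) :
    dot ((List.range n).map f) ((List.range n).map g) =
      ∑ i ∈ Finset.range n, bif g i then f i else 0 := by
  rw [dot_map, sum_map_range_eq]

theorem weight_map_range (q : ℕ) (g : ℕ → Bool) :
    weight q ((List.range (q + 1)).map g) =
      (∑ i ∈ Finset.range (q + 1), bif g i then 1 else 0) +
      ∑ j ∈ Finset.range (q + 1), dot ((List.range (q + 1)).map fun i => entryU q i j)
        ((List.range (q + 1)).map g) % 3 := by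
  have h1 (l : List ℕ) (n : ℕ) : (l.map g).foldr (fun b n => bif b then n.succ else n) n =
      (l.map fun i => bif g i then 1 else 0).sum + n := by
    induction l with
    | nil => simp
    | cons x l ih =>
      cases h : g x <;> simp only [List.map_cons, List.foldr_cons, List.sum_cons, ih, h,
        cond_true, cond_false] <;> omega
  have h2 (a : List Bool) (l : List (List ℕ)) :
      l.foldr (fun c n => Nat.add (Nat.mod (dot c a) 3) n) 0 =
        (l.map fun c => dot c a % 3).sum := by
    induction l with
    | nil => rfl
    | cons x l ih => rw [List.foldr_cons, ih, List.map_cons, List.sum_cons]; rfl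
  rw [weight, h1, h2, sum_map_range_eq, columnsU, List.map_map, sum_map_range_eq]
  rfl

section Field

variable (F : Type) [Field F]

/-- The enumeration `∞, 0, 1, 2, …` of `GF(q) ∪ {∞}` for a prime `q`. -/
def enumField : ℕ → Option F
  | 0 => none
  | i + 1 => some (i : F)

variable {F} {q : ℕ}

theorem enumField_injOn [CharP F q] : Set.InjOn (enumField F) (Finset.range (q + 1)) := by
  intro i hi j hj h
  simp only [Finset.coe_range, Set.mem_Iio] at hi hj
  obtain _ | i := i <;> obtain _ | j := j <;> simp only [enumField, reduceCtorEq] at h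
  · rfl
  · rw [CharP.natCast_injOn_Iio F q (show i ∈ Set.Iio q by simpa using hi)
      (show j ∈ Set.Iio q by simpa using hj) (Option.some.inj h)]

theorem one_enumField [DecidableEq F] [CharP F q] {i k : ℕ} (hi : i < q + 1) (hk : k < q + 1) :
    (((1 : Matrix (Option F) (Option F) ℤ) (enumField F i) (enumField F k) : ℤ) : ZMod 3) =
      ((bif i == k then 1 else 0 : ℕ) : ZMod 3) := by
  have h : enumField F i = enumField F k ↔ i = k :=
    enumField_injOn.eq_iff (s := Finset.range (q + 1)) (by simpa using hi) (by simpa using hk)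
  obtain rfl | hik := eq_or_ne i k
  · rw [Matrix.one_apply_eq]
    simp
  · rw [Matrix.one_apply_ne (h.not.2 hik), beq_eq_false_iff_ne.2 hik]
    simp

variable [Fintype F]

theorem exists_natCast_eq [CharP F q] (hF : Fintype.card F = q) (x : F) :
    ∃ i < q, (i : F) = x := by
  classical
  have h : (Finset.range q).image (fun i : ℕ => (i : F)) = Finset.univ := by
    refine Finset.eq_univ_of_card _ ?_
    rw [Finset.card_image_of_injOn, Finset.card_range, hF]
    simpa using CharP.natCast_injOn_Iio F q
  have hx : x ∈ (Finset.range q).image (fun i : ℕ => (i : F)) := h ▸ Finset.mem_univ x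
  simpa using hx

theorem exists_enumField_eq [CharP F q] (hF : Fintype.card F = q) (o : Option F) :
    ∃ i < q + 1, enumField F i = o := by
  obtain _ | x := o
  · exact ⟨0, by omega, rfl⟩
  · obtain ⟨i, hi, rfl⟩ := exists_natCast_eq hF x
    exact ⟨i + 1, by omega, rfl⟩

theorem sum_enumField [CharP F q] (hF : Fintype.card F = q) {M : Type*} [AddCommMonoid M]
    (f : Option F → M) : ∑ o, f o = ∑ i ∈ Finset.range (q + 1), f (enumField F i) := by
  refine (Finset.sum_nbij (enumField F) (by simp) enumField_injOn ?_ (by simp)).symm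
  intro o _
  obtain ⟨i, hi, rfl⟩ := exists_enumField_eq hF o
  exact ⟨i, by simpa using hi, rfl⟩

variable [DecidableEq F]

theorem quadraticChar_natCast [CharP F q] (hF : Fintype.card F = q) (x : ℕ) :
    ((quadraticChar F (x : F) : ℤ) : ZMod 3) = (charNat q x : ℕ) := by
  rw [quadraticChar_apply, quadraticCharFun, charNat]
  have h0 : (x : F) = 0 ↔ x % q = 0 := by
    rw [CharP.cast_eq_zero_iff F q, Nat.dvd_iff_mod_eq_zero]
  by_cases hx : x % q = 0
  · simp [h0, hx]
  have hx' : (x % q == 0) = false := by simpa using hx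
  have hsq : IsSquare (x : F) ↔
      (List.range q).any (fun y => y * y % q == x % q) = true := by
    simp only [List.any_eq_true, List.mem_range, beq_iff_eq]
    constructor
    · rintro ⟨r, hr⟩
      obtain ⟨y, hy, rfl⟩ := exists_natCast_eq hF r
      refine ⟨y, hy, ?_⟩
      have : ((y * y : ℕ) : F) = (x : ℕ) := by push_cast; exact hr.symm
      exact (CharP.natCast_eq_natCast F q).1 this
    · rintro ⟨y, _, h⟩
      refine ⟨y, ?_⟩
      have : ((y * y : ℕ) : F) = (x : ℕ) := (CharP.natCast_eq_natCast F q).2 h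
      rw [← this]; push_cast; rfl
  rw [if_neg (h0.not.2 hx), hx', cond_false]
  cases h : (List.range q).any (fun y => y * y % q == x % q) <;> rw [h] at hsq
  · rw [if_neg (by simpa using hsq)]
    decide
  · rw [if_pos (hsq.2 rfl)]
    decide

theorem Umat_enumField [CharP F q] (hF : Fintype.card F = q) {i j : ℕ} (hj : j < q + 1) :
    ((Umat F (enumField F i) (enumField F j) : ℤ) : ZMod 3) = (entryU q i j : ℕ) := by
  obtain _ | i := i <;> obtain _ | j := j
  · simp [enumField, Umat, Smat, entryU]
  · simp [enumField, Umat, Smat, entryU]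
  · simp only [enumField, Umat, entryU]
    decide
  · have h : (i : F) - (j : F) = ((i + (q - j) : ℕ) : F) := by
      rw [Nat.cast_add, Nat.cast_sub (by omega), CharP.cast_eq_zero F q]
      ring
    simp only [enumField, Umat, Smat, entryU]
    rw [h, quadraticChar_natCast hF]

theorem mem_Lcode_iff (v : (Option F ⊕ Option F) → ZMod 3) : v ∈ Lcode F ↔
    ∀ k, v (Sum.inr k) = ∑ i, v (Sum.inl i) * ((Umat F i k : ℤ) : ZMod 3) := by
  rw [Lcode, Submodule.mem_span_range_iff_exists_fun]
  constructor
  · rintro ⟨c, rfl⟩ k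
    simp [genRowL, Finset.sum_apply]
  · intro h
    refine ⟨fun i => v (Sum.inl i), ?_⟩
    funext j
    obtain k | k := j
    · simp [genRowL, Finset.sum_apply]
    · rw [h]
      simp [genRowL, Finset.sum_apply]

/-- The positions of the entries `1` in the left half of `v`. -/
def leftOnes (q : ℕ) (v : (Option F ⊕ Option F) → ZMod 3) : List Bool :=
  (List.range (q + 1)).map fun k => decide (v (Sum.inl (enumField F k)) = 1)

theorem right_eq_dot [CharP F q] (hF : Fintype.card F = q)
    {v : (Option F ⊕ Option F) → ZMod 3} (hv : v ∈ Lcode F) (h01 : ∀ j, v j = 0 ∨ v j = 1)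
    {k : ℕ} (hk : k < q + 1) : v (Sum.inr (enumField F k)) =
      (dot ((List.range (q + 1)).map fun i => entryU q i k) (leftOnes q v) : ℕ) := by
  rw [(mem_Lcode_iff v).1 hv, sum_enumField hF, leftOnes, dot_map_range, Nat.cast_sum]
  refine Finset.sum_congr rfl fun i _ => ?_
  rw [Umat_enumField hF hk]
  rcases h01 (Sum.inl (enumField F i)) with h | h <;> simp [h]

theorem dot_mod_of_mem [CharP F q] (hF : Fintype.card F = q)
    {v : (Option F ⊕ Option F) → ZMod 3} (hv : v ∈ Lcode F) (h01 : ∀ j, v j = 0 ∨ v j = 1)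
    {k : ℕ} (hk : k < q + 1) :
    dot ((List.range (q + 1)).map fun i => entryU q i k) (leftOnes q v) % 3 =
      if v (Sum.inr (enumField F k)) ≠ 0 then 1 else 0 := by
  have h := right_eq_dot hF hv h01 hk
  rcases h01 (Sum.inr (enumField F k)) with h' | h' <;> rw [h'] at h ⊢
  · rw [← Nat.cast_zero, ZMod.natCast_eq_natCast_iff'] at h
    simpa using h.symm
  · rw [← Nat.cast_one, ZMod.natCast_eq_natCast_iff'] at h
    simpa using h.symm

theorem card_support_eq_weight [CharP F q] (hF : Fintype.card F = q)
    {v : (Option F ⊕ Option F) → ZMod 3} (hv : v ∈ Lcode F) (h01 : ∀ j, v j = 0 ∨ v j = 1) :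
    (Finset.univ.filter (fun j => v j ≠ 0)).card = weight q (leftOnes q v) := by
  rw [Finset.card_filter, Fintype.sum_sum_type, sum_enumField hF, sum_enumField hF,
    leftOnes, weight_map_range]
  congr 1
  · refine Finset.sum_congr rfl fun i _ => ?_
    rcases h01 (Sum.inl (enumField F i)) with h | h <;> simp [h]
  · refine Finset.sum_congr rfl fun k hk => ?_
    exact (dot_mod_of_mem hF hv h01 (by simpa using hk)).symm

theorem eq_of_leftOnes_eq [CharP F q] (hF : Fintype.card F = q)
    {v w : (Option F ⊕ Option F) → ZMod 3} (hv : v ∈ Lcode F) (hv01 : ∀ j, v j = 0 ∨ v j = 1)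
    (hw : w ∈ Lcode F) (hw01 : ∀ j, w j = 0 ∨ w j = 1) (h : leftOnes q v = leftOnes q w) :
    v = w := by
  funext j
  obtain o | o := j <;> obtain ⟨k, hk, rfl⟩ := exists_enumField_eq hF o
  · have hk' := List.map_inj_left.1 h k (List.mem_range.2 hk)
    rw [decide_eq_decide] at hk'
    rcases hv01 (Sum.inl (enumField F k)) with h1 | h1 <;>
      rcases hw01 (Sum.inl (enumField F k)) with h2 | h2 <;> simp_all
  · rw [right_eq_dot hF hv hv01 hk, right_eq_dot hF hw hw01 hk, h]

/-- The vector `dvec` described by an index triple. -/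
def dvecOf (F : Type) [Field F] [Fintype F] [DecidableEq F] (x : Bool × Bool × ℕ) :
    (Option F ⊕ Option F) → ZMod 3 :=
  dvec F x.1 (bif x.2.1 then Sum.inr (enumField F x.2.2) else Sum.inl (enumField F x.2.2))

theorem mem_dvecIndices {x : Bool × Bool × ℕ} (hx : x ∈ dvecIndices q) :
    x.2.2 < q + 1 ∧ (x.2.1 = false → x.2.2 ≠ 0) := by
  simp only [dvecIndices, List.mem_flatMap, List.mem_append, List.mem_map, List.mem_range] at hx
  obtain ⟨s, -, ⟨i, hi, rfl⟩ | ⟨i, hi, rfl⟩⟩ := hx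
  · simpa using hi
  · simpa using hi

theorem length_dvecIndices (q : ℕ) : (dvecIndices q).length = 4 * q + 2 := by
  simp [dvecIndices]
  ring

theorem dvecOf_inl [CharP F q] (hF : Fintype.card F = q) {x : Bool × Bool × ℕ}
    (hx : x.2.2 < q + 1) {k : ℕ} (hk : k < q + 1) :
    dvecOf F x (Sum.inl (enumField F k)) = (leftEntry q x k : ℕ) := by
  obtain ⟨s, t, i⟩ := x
  have h3 : (2 : ZMod 3) = -1 := by decide
  cases s <;> cases t <;>
    simp [dvecOf, dvec, Hmat, leftEntry, one_enumField hx hk, Umat_enumField hF hx, h3] <;> ring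

theorem dvecOf_inr [CharP F q] (hF : Fintype.card F = q) {x : Bool × Bool × ℕ}
    (hx : x.2.2 < q + 1) {k : ℕ} (hk : k < q + 1) :
    dvecOf F x (Sum.inr (enumField F k)) = (rightEntry q x k : ℕ) := by
  obtain ⟨s, t, i⟩ := x
  have h3 : (2 : ZMod 3) = -1 := by decide
  cases s <;> cases t <;>
    simp [dvecOf, dvec, Hmat, rightEntry, one_enumField hx hk, Umat_enumField hF hk, h3] <;> ring

theorem dvecOf_spec [CharP F q] (hF : Fintype.card F = q) (hq : checkDvec q = true)
    {x : Bool × Bool × ℕ} (hx : x ∈ dvecIndices q) :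
    dvecOf F x ∈ Lcode F ∧ (∀ j, dvecOf F x j = 0 ∨ dvecOf F x j = 1) ∧
      leftOnes q (dvecOf F x) = leftHalf q x ∧ weight q (leftHalf q x) = q + 1 := by
  have hi := (mem_dvecIndices hx).1
  have hq' := List.all_eq_true.1 hq x hx
  simp only [Bool.and_eq_true, beq_iff_eq, List.all_eq_true, bne_iff_ne, List.mem_range] at hq'
  obtain ⟨hw, hk⟩ := hq'
  have h01 (j) : dvecOf F x j = 0 ∨ dvecOf F x j = 1 := by
    obtain o | o := j <;> obtain ⟨k, hk', rfl⟩ := exists_enumField_eq hF o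
    · rw [dvecOf_inl hF hi hk']
      have h1 : leftEntry q x k < 3 := Nat.mod_lt _ (by decide)
      have h2 := (hk k hk').1.1
      interval_cases leftEntry q x k <;> simp_all
    · rw [dvecOf_inr hF hi hk']
      have h1 : rightEntry q x k < 3 := Nat.mod_lt _ (by decide)
      have h2 := (hk k hk').1.2
      interval_cases rightEntry q x k <;> simp_all
  have hleft : leftOnes q (dvecOf F x) = leftHalf q x := by
    refine List.map_inj_left.2 fun k hk' => ?_
    have hk' := List.mem_range.1 hk'
    rw [dvecOf_inl hF hi hk']
    have h1 : leftEntry q x k < 3 := Nat.mod_lt _ (by decide)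
    interval_cases leftEntry q x k <;> decide
  refine ⟨(mem_Lcode_iff _).2 fun o => ?_, h01, hleft, hw⟩
  obtain ⟨k, hk', rfl⟩ := exists_enumField_eq hF o
  rw [dvecOf_inr hF hi hk', ← (hk k hk').2, ZMod.natCast_mod, ← hleft, sum_enumField hF,
    leftOnes, dot_map_range, Nat.cast_sum]
  refine Finset.sum_congr rfl fun i _ => ?_
  rw [Umat_enumField hF hk']
  rcases h01 (Sum.inl (enumField F i)) with h | h <;> simp [h]

theorem exists_dvecOf_eq [CharP F q] (hF : Fintype.card F = q) (hq : checkDvec q = true)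
    {p : ℕ} (hp : p ≤ q + 1) (hs : checkSearch q p = true)
    {v : (Option F ⊕ Option F) → ZMod 3} (hv : v ∈ Lcode F) (h01 : ∀ j, v j = 0 ∨ v j = 1)
    (hw : (Finset.univ.filter (fun j => v j ≠ 0)).card = q + 1) :
    ∃ x ∈ dvecIndices q, dvecOf F x = v := by
  have h := search_spec hs (a := leftOnes q v) (by simp [leftOnes, hp])
    (by simp [columnsU, hp]) (by
      intro c hc
      simp only [columnsU, List.mem_map, List.mem_range] at hc
      obtain ⟨k, hk, rfl⟩ := hc
      rw [dot_mod_of_mem hF hv h01 hk]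
      split_ifs <;> decide)
  rw [card_support_eq_weight hF hv h01] at hw
  simp only [hw, beq_self_eq_true, cond_true, List.elem_eq_mem, decide_eq_true_eq,
    List.mem_map] at h
  obtain ⟨x, hx, hxv⟩ := h
  obtain ⟨hm, hm01, hleft, -⟩ := dvecOf_spec hF hq hx
  exact ⟨x, hx, eq_of_leftOnes_eq hF hm hm01 hv h01 (hleft.trans hxv)⟩

theorem codewords_of_checks [CharP F q] (hF : Fintype.card F = q) (hq : checkDvec q = true)
    (hnd : ((dvecIndices q).map (leftHalf q)).Nodup) {p : ℕ} (hp : p ≤ q + 1)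
    (hs : checkSearch q p = true) :
    Set.ncard {v : (Option F ⊕ Option F) → ZMod 3 | v ∈ Lcode F ∧
      (∀ j, v j = 0 ∨ v j = 1) ∧
      (Finset.univ.filter (fun j => v j ≠ 0)).card = q + 1} = 4 * q + 2 ∧
    (∀ v : (Option F ⊕ Option F) → ZMod 3, v ∈ Lcode F →
      (∀ j, v j = 0 ∨ v j = 1) →
      (Finset.univ.filter (fun j => v j ≠ 0)).card = q + 1 →
      ∃ (s : Bool) (i : Option F ⊕ Option F), i ≠ Sum.inl none ∧ v = dvec F s i) := by
  constructor
  · have hset : {v : (Option F ⊕ Option F) → ZMod 3 | v ∈ Lcode F ∧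
        (∀ j, v j = 0 ∨ v j = 1) ∧ (Finset.univ.filter (fun j => v j ≠ 0)).card = q + 1} =
        (((dvecIndices q).map (dvecOf F)).toFinset : Set _) := by
      ext v
      simp only [Set.mem_ofPred_eq, List.coe_toFinset, List.mem_map]
      constructor
      · rintro ⟨hv, h01, hw⟩
        exact exists_dvecOf_eq hF hq hp hs hv h01 hw
      · rintro ⟨x, hx, rfl⟩
        obtain ⟨hm, hm01, hleft, hw⟩ := dvecOf_spec (F := F) hF hq hx
        exact ⟨hm, hm01, by rw [card_support_eq_weight hF hm hm01, hleft, hw]⟩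
    have hnd' : ((dvecIndices q).map (dvecOf F)).Nodup := by
      refine List.Nodup.of_map (leftOnes q) ?_
      rw [List.map_map]
      convert hnd using 1
      exact List.map_congr_left fun x hx => (dvecOf_spec (F := F) hF hq hx).2.2.1
    rw [hset, Set.ncard_coe_finset, List.toFinset_card_of_nodup hnd', List.length_map,
      length_dvecIndices]
  · intro v hv h01 hw
    obtain ⟨⟨s, t, i⟩, hx, rfl⟩ := exists_dvecOf_eq hF hq hp hs hv h01 hw
    refine ⟨s, _, ?_, rfl⟩
    have := (mem_dvecIndices hx).2
    obtain _ | i := i <;> cases t <;> simp_all [enumField]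

end Field

set_option maxRecDepth 100000 in
theorem checks :
    (checkDvec 5 = true ∧ ((dvecIndices 5).map (leftHalf 5)).Nodup ∧ checkSearch 5 2 = true) ∧
    (checkDvec 11 = true ∧ ((dvecIndices 11).map (leftHalf 11)).Nodup ∧ checkSearch 11 3 = true) ∧
    (checkDvec 17 = true ∧ ((dvecIndices 17).map (leftHalf 17)).Nodup ∧ checkSearch 17 4 = true) ∧
    (checkDvec 23 = true ∧ ((dvecIndices 23).map (leftHalf 23)).Nodup ∧ checkSearch 23 6 = true) := by
  refine ⟨⟨?_, ?_, ?_⟩, ⟨?_, ?_, ?_⟩, ⟨?_, ?_, ?_⟩, ⟨?_, ?_, ?_⟩⟩ <;> decide +kernel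

/-- (Theorem 2) For `q ∈ {5, 11, 17, 23}`, the code `L(q)` contains exactly `4q+2`
`(0,1)`-codewords of weight `q+1`, and each of them equals `r + 2·1̄` for some row `r`
of `H` or of `−H` (mod 3) other than the all-one row of `H` and its negative. -/
theorem stmt_6 (q : ℕ) (hq : q = 5 ∨ q = 11 ∨ q = 17 ∨ q = 23)
    (F : Type) [Field F] [Fintype F] [DecidableEq F] (hF : Fintype.card F = q) :
    Set.ncard {v : (Option F ⊕ Option F) → ZMod 3 | v ∈ Lcode F ∧
      (∀ j, v j = 0 ∨ v j = 1) ∧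
      (Finset.univ.filter (fun j => v j ≠ 0)).card = q + 1} = 4 * q + 2 ∧
    (∀ v : (Option F ⊕ Option F) → ZMod 3, v ∈ Lcode F →
      (∀ j, v j = 0 ∨ v j = 1) →
      (Finset.univ.filter (fun j => v j ≠ 0)).card = q + 1 →
      ∃ (s : Bool) (i : Option F ⊕ Option F), i ≠ Sum.inl none ∧ v = dvec F s i) := by
  have hp : q.Prime := by rcases hq with rfl | rfl | rfl | rfl <;> norm_num
  have := Fact.mk hp
  have : CharP F q := charP_of_card_eq_prime hF
  obtain ⟨h5, h11, h17, h23⟩ := checks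
  rcases hq with rfl | rfl | rfl | rfl
  · exact codewords_of_checks hF h5.1 h5.2.1 (by norm_num) h5.2.2
  · exact codewords_of_checks hF h11.1 h11.2.1 (by norm_num) h11.2.2
  · exact codewords_of_checks hF h17.1 h17.2.1 (by norm_num) h17.2.2
  · exact codewords_of_checks hF h23.1 h23.2.1 (by norm_num) h23.2.2
end

section
/- (Theorem 3(i), existence) There exists a Hadamard matrix H' of order 36 with the following properties: every row of H', reduced modulo 3 (reading −1 as 2), is a codeword of L(17); every row of H' has exactly 15 entries equal to +1 (so H' is a regular Hadamard matrix); H' is not equivalent to the Hadamard matrix H = [[I_{18} − U_{17}ᵀ, U_{17} + I_{18}], [I_{18} + U_{17}ᵀ, U_{17} − I_{18}]]; the full automorphism group of H' has order 72; the rows of H' reduced modulo 3 span L(17) (equivalently, H' has 3-rank 18); and the (0,1)-matrix N = (H' + J)/2 (J the all-one matrix) is the incidence matrix of a symmetric 2-(36,15,6) design whose only automorphism is the identity (i.e., the identity is the only permutation of the 36 columns of N that maps the set of rows of N onto itself). -/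
open Matrix Finset

instance : Fact (Nat.Prime 17) := ⟨by norm_num⟩

/-- The 36-element coordinate index set of `L(17)`. -/
abbrev idx := Option (ZMod 17) ⊕ Option (ZMod 17)

/-- A Hadamard matrix of order 36: a ±1 integer matrix `M` with `M Mᵀ = 36 I`. -/
def IsHadamard36 (M : Matrix idx idx ℤ) : Prop :=
  (∀ i j, M i j = 1 ∨ M i j = -1) ∧ M * Mᵀ = (36 : ℤ) • (1 : Matrix idx idx ℤ)

/-- A monomial `{0, ±1}` integer matrix: every entry is `0`, `1` or `-1`, and every row
and every column contains exactly one nonzero entry. -/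
def IsMonomialZ (M : Matrix idx idx ℤ) : Prop :=
  (∀ i j, M i j = 0 ∨ M i j = 1 ∨ M i j = -1) ∧
  (∀ i, ∃! j, M i j ≠ 0) ∧ (∀ j, ∃! i, M i j ≠ 0)

/-- Equivalence of Hadamard matrices: `M` and `N` are equivalent if `L M R = N` for some
monomial `{0, ±1}` matrices `L`, `R`. -/
def HadEquiv (M N : Matrix idx idx ℤ) : Prop :=
  ∃ L R : Matrix idx idx ℤ, IsMonomialZ L ∧ IsMonomialZ R ∧ L * M * R = N

/-- Row `i` of the matrix: bit `j` is set when the entry at `(i, j)` is `-1`. -/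
def negRows : List ℕ := [
    68373972823, 26478489007, 57522433013, 34293642885, 46491448251, 32245731511, 48849795101,
    27773786573, 64664796734, 33867037402, 63195346288, 11540014809, 43585896195, 20651658041,
    54712852607, 22003898347, 62693023196, 8472116331, 51342790075, 58978646944, 54891199719,
    6815194967, 7513663894, 5961151868, 37790479310, 65948606787, 50089778029, 48166273774,
    56128007897, 55626878478, 27873090162, 10094014454, 33654155052, 50721443040, 36422407861,
    57675290010]

/-- Column `j` of the matrix: bit `i` is set when the entry at `(i, j)` is `-1`. -/
def negCols : List ℕ := [
    17552570623, 38310171443, 24393105903, 39687023570, 55044304757, 33497736502, 12343037573,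
    62702586558, 40935208087, 25722141469, 67389332747, 12691911622, 52709529592, 6775529310,
    28852942760, 31737109094, 66017391130, 45813037500, 38650260586, 10632803455, 66427424182,
    66994206435, 23016192417, 58759298660, 51352492273, 26490744787, 48477044172, 63473183051,
    25676465368, 53365071503, 68242776797, 13514010169, 47763587949, 16341344251, 40569005999,
    61188429141]

/-- Hexadecimal digit `k` of entry `j` is the number of rows `l` for which the rows
`0, j, k, l` have generalized inner product `±20`. -/
def quadTable : List ℕ := [
    0, 79228162514264355185729994752, 340365443671005057454185890237242146816, 1152922604403687424,
    340287559217796998292156340907680989184, 21267668214968257618135841610875797504, 1099511631872,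
    1393796574908163946345983544962031495942144, 1480908860840008392262831701042644178173952,
    361550014858758362596798386564575002624, 361633113232522041361204076558685311232,
    79228162514336395191876845584, 1152921504606912512, 21267647932558658688827395838426742784,
    340282366920938468185741107897894436864, 281475245215744,
    87133553579777294708271587619263307841536, 1267650600228229402596214833152,
    361550035135906721081582505541465276416, 0, 309485009821345068724781312,
    83076754688317399198009045158985984, 21267648011788025424991609329633198336,
    361550014853516460261396098609773019136, 1481249143208113091541326163659822154645520,
    1393796574908243174508791804284395002527744, 21267647932558658688827396933643403264, 0,
    340282366920938463463374607431768276992, 21267647932577996779574748130792440064, 0,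
    83097037407410801507509768054374400, 87112291124141285108845372433354046112000, 0,
    340282367000166625996085689103316680704, 1346878762742493739094810558464]

/-- Hexadecimal digit `k` of entry `j` is the number of rows `l` for which the rows `j, k, l` have
generalized inner product `-10`. -/
def tripleTable : List ℕ := [
    5936336405188339791403667679304624891061328, 3061633799220499747451096667250370650854405,
    7520374915460048725942479253446949903609924, 7346490698658298639769713533209804316869462,
    6033318469170286424100756964158038555510085, 7248063955877521247424129033169098332451909,
    4635056927939572299254754831946289973118003, 7417161690127090746694622422864128904615237,
    7428452158586246123443616364986421507016020, 5946866555212291786001544388401226623305044,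
    5946547788405191967111419627836405169079363, 4639839656400271967900039414787090380313939,
    7257972021986777464108683869450567909922133, 8734821171298587701366761228697589886707028,
    8739921756636734563240335697470748548674884, 7330089276838003625618235991144637701301332,
    7340683311910283047491709336335973362254658, 6039422278346374694895785336490307020477508,
    7351889950064738827943875357604475294729557, 7248445444290682522104666883547961163531605,
    7330134402785695348311273800544084290786387, 7428134556192280644290233388473314945811539,
    7433220182483790936583144688201218952279090, 7416543755570073278677923648651204789158978,
    7428137115343941003474481246803896753804117, 6039762477306966974305670990085715658036037,
    7438303061988323911424539282976361545815365, 5854584884057867326288166694872906790749252,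
    5946888044810385998490187659280352514810964, 5941420540640368858455975213171974196253762,
    6039778428392852291937142636599723800417619, 5931128660231273255393716380181136054511189,
    7519013786279007532856835446803997296579669, 5838252754151806159924901697029964498752802,
    6987450193244174459150415457368473951618612, 459131654961225157112387726324479162602788]

/-- Row labels after one refinement step with `quadTable`. -/
def quadLabelA : List ℕ := [
    0, 2, 6, 4, 4, 4, 2, 4, 12, 4, 12, 4, 2, 4, 4, 4, 6, 2, 6, 0, 2, 4, 6, 6, 10, 4, 4, 0, 2, 4, 0,
    10, 10, 0, 4, 4]

/-- Row labels after two refinement steps with `quadTable`. -/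
def quadLabelB : List ℕ := [
    0, 116, 316, 180, 124, 276, 160, 192, 464, 272, 568, 264, 32, 296, 296, 52, 432, 160, 392, 0,
    72, 232, 292, 412, 528, 264, 296, 0, 116, 296, 0, 368, 420, 0, 380, 276]

/-- Row labels after three refinement steps with `quadTable`. -/
def quadLabelC : List ℕ := [
    0, 8242, 401, 7526, 3451, 2839, 4779, 6352, 6470, 6440, 9554, 4739, 8073, 154, 4629, 5608, 8198,
    2047, 9422, 0, 4994, 2113, 9317, 964, 8687, 2694, 7412, 0, 1643, 1301, 0, 10004, 8559, 0, 6509,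
    220]

/-- Row labels after one refinement step with `tripleTable`. -/
def tripleLabelA : List ℕ := [
    138, 150, 154, 152, 150, 144, 148, 142, 150, 154, 138, 144, 148, 148, 154, 142, 138, 148, 152,
    150, 152, 144, 140, 128, 152, 162, 150, 122, 154, 142, 144, 144, 154, 132, 152, 158]

/-- Row labels after two refinement steps with `tripleTable`. -/
def tripleLabelB : List ℕ := [
    6214, 2959, 7458, 2386, 4913, 9776, 4517, 1565, 5921, 6610, 7204, 5607, 1959, 2635, 4280, 4107,
    3353, 4039, 2275, 565, 5997, 8516, 307, 9232, 5043, 9089, 8633, 1878, 3973, 3358, 815, 1695,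
    1787, 5989, 4260, 635]

/-- Hexadecimal digits of a left inverse modulo 3 of the first 18 columns. -/
def leftInvTable : List ℕ := [
    611125559106083099169, 334347518987784425745, 627198324539098398978, 590368168119687586322,
    2454779702092632352, 314901275959732805632, 628423882946958655520, 314747589522954002705,
    629643760445061927457, 333275678692390084882, 314896190654027665442, 333348020037737250833,
    611125277635668611361, 2310928323775103505, 37042669954350060048, 592755077158891758080,
    590300913338485379362, 39343464014507220994]

/-- The row permutation of the rotation. -/
def rotRow : List ℕ := [
    17, 0, 1, 2, 3, 4, 5, 6, 7, 8, 9, 10, 11, 12, 13, 14, 15, 16, 19, 20, 21, 22, 23, 24, 25, 26,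
    27, 28, 29, 30, 31, 32, 33, 34, 35, 18]

/-- The column permutation of the rotation. -/
def rotCol : List ℕ := [
    34, 20, 28, 31, 18, 27, 32, 29, 23, 22, 35, 26, 25, 19, 33, 21, 30, 24, 16, 2, 10, 13, 0, 9, 14,
    11, 5, 4, 17, 8, 7, 1, 15, 3, 12, 6]

/-- Rows negated by the rotation. -/
def rotRowNeg : ℕ := 2939762593

/-- Columns negated by the rotation. -/
def rotColNeg : ℕ := 62325676870

/-- The row permutation of the reflection. -/
def swpRow : List ℕ := [
    18, 19, 20, 21, 22, 23, 24, 25, 26, 27, 28, 29, 30, 31, 32, 33, 34, 35, 0, 1, 2, 3, 4, 5, 6, 7,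
    8, 9, 10, 11, 12, 13, 14, 15, 16, 17]

/-- The column permutation of the reflection. -/
def swpCol : List ℕ := [
    15, 5, 8, 4, 3, 1, 12, 17, 2, 13, 11, 10, 6, 9, 16, 0, 14, 7, 33, 23, 26, 22, 21, 19, 30, 35,
    20, 31, 29, 28, 24, 27, 34, 18, 32, 25]

/-- Rows negated by the reflection. -/
def swpRowNeg : ℕ := 15027085332

/-- Columns negated by the reflection. -/
def swpColNeg : ℕ := 42150628200

/-- The sign encoded by a bit. -/
def bitSign (b : Bool) : ℤ := bif b then -1 else 1

/-- The number of ones among the six lowest bits of `y`, for `y < 64`, read off a table. -/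
def popSix (y : ℕ) : ℕ :=
  Nat.land (Nat.shiftRight 5266721624626081916652898579601397356032429460333936579656
    (Nat.mul 3 y)) 7

/-- The number of ones among the 36 lowest bits of `x`. The functions on `ℕ` are written out, as
the kernel evaluates them faster in this form. -/
def popCount (x : ℕ) : ℕ :=
  Nat.add (popSix (Nat.mod x 64)) <| Nat.add (popSix (Nat.mod (Nat.div x 64) 64)) <|
    Nat.add (popSix (Nat.mod (Nat.div x 4096) 64)) <|
    Nat.add (popSix (Nat.mod (Nat.div x 262144) 64)) <|
    Nat.add (popSix (Nat.mod (Nat.div x 16777216) 64)) (popSix (Nat.mod (Nat.div x 1073741824) 64))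

/-- Decide a statement for all pairs of indices below 36. -/
def allPairs (f : ℕ → ℕ → Bool) : Bool :=
  (List.range 36).all fun i => (List.range 36).all fun j => f i j

theorem allPairs_spec {f : ℕ → ℕ → Bool} (h : allPairs f = true) (i j : Fin 36) :
    f i j = true := by
  simp only [allPairs, List.all_eq_true, List.mem_range] at h
  exact h i i.2 j j.2

/-- The hexadecimal digit number `k` of the entry number `j` of the table `t`. -/
def hexDigit (t : List ℕ) (j k : ℕ) : ℕ := t.getD j 0 >>> (4 * k) % 16

/-- The number of rows `l` for which the number of ones of the sum of the masks `m` and `l`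
satisfies `φ`. -/
def countRows (φ : ℕ → Bool) (m : ℕ) : ℕ :=
  (negRows.map fun x => bif φ (popCount (Nat.xor m x)) then 1 else 0).sum

theorem quadTable_spec : allPairs (fun j k =>
    countRows (fun d => Nat.beq d 8 || Nat.beq d 28)
      (negRows.getD 0 0 ^^^ negRows.getD j 0 ^^^ negRows.getD k 0) ==
    hexDigit quadTable j k) = true := by decide +kernel

theorem tripleTable_spec : allPairs (fun j k =>
    countRows (fun d => Nat.beq d 23) (negRows.getD j 0 ^^^ negRows.getD k 0) ==
    hexDigit tripleTable j k) = true := by decide +kernel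

theorem popSix_eq (y : ℕ) : popSix (y % 64) =
    y % 2 + y / 2 % 2 + y / 4 % 2 + y / 8 % 2 + y / 16 % 2 + y / 32 % 2 := by
  have h : ∀ z < 64, popSix z =
      z % 2 + z / 2 % 2 + z / 4 % 2 + z / 8 % 2 + z / 16 % 2 + z / 32 % 2 := by decide +kernel
  rw [h _ (Nat.mod_lt _ (by norm_num))]
  omega

theorem bitSign_testBit (x c : ℕ) : bitSign (x.testBit c) = 1 - 2 * ((x / 2 ^ c % 2 : ℕ) : ℤ) := by
  rw [Nat.testBit_eq_decide_div_mod_eq]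
  rcases Nat.mod_two_eq_zero_or_one (x / 2 ^ c) with h | h <;> simp [bitSign, h]

theorem sum_bitSign_testBit (x : ℕ) :
    ∑ c : Fin 36, bitSign (x.testBit c) = 36 - 2 * (popCount x : ℤ) := by
  simp only [bitSign_testBit]
  rw [Fin.sum_univ_eq_sum_range (fun c => 1 - 2 * ((x / 2 ^ c % 2 : ℕ) : ℤ)) 36,
    Finset.sum_sub_distrib, ← Finset.mul_sum, ← Nat.cast_sum]
  have h : ∑ c ∈ Finset.range 36, x / 2 ^ c % 2 = popCount x := by
    have e : popCount x = popSix (x % 64) + (popSix (x / 64 % 64) + (popSix (x / 4096 % 64) +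
      (popSix (x / 262144 % 64) + (popSix (x / 16777216 % 64) +
        popSix (x / 1073741824 % 64))))) := rfl
    rw [e]
    simp only [popSix_eq, Nat.div_div_eq_div_mul, Finset.sum_range_succ, Finset.sum_range_zero]
    norm_num
    ring
  rw [h]
  simp

theorem bitSign_mul (a b : Bool) : bitSign a * bitSign b = bitSign (a ^^ b) := by
  cases a <;> cases b <;> rfl

theorem bitSign_eq (b : Bool) : bitSign b = 1 ∨ bitSign b = -1 := by cases b <;> simp [bitSign]

/-- The Hadamard matrix, indexed by `Fin 36`. -/
def entry (i j : Fin 36) : ℤ := bitSign ((negRows.getD i 0).testBit j)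

theorem entry_eq_or (i j : Fin 36) : entry i j = 1 ∨ entry i j = -1 := bitSign_eq _

theorem entry_eq_col (i j : Fin 36) : entry i j = bitSign ((negCols.getD j 0).testBit i) := by
  have h : allPairs (fun i j => (negRows.getD i 0).testBit j == (negCols.getD j 0).testBit i)
      = true := by decide +kernel
  have := allPairs_spec h i j
  rw [beq_iff_eq] at this
  rw [entry, this]

theorem sum_row (i : Fin 36) : ∑ c, entry i c = -6 := by
  have h : allPairs (fun i _ => popCount (negRows.getD i 0) == 21) = true := by decide +kernel
  have := allPairs_spec h i 0
  rw [beq_iff_eq] at this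
  simp only [entry]
  rw [sum_bitSign_testBit, this]
  norm_num

theorem sum_col (j : Fin 36) : ∑ c, entry c j = -6 := by
  have h : allPairs (fun i _ => popCount (negCols.getD i 0) == 21) = true := by decide +kernel
  have := allPairs_spec h j 0
  rw [beq_iff_eq] at this
  simp only [entry_eq_col]
  rw [sum_bitSign_testBit, this]
  norm_num

theorem sum_row_mul_row (i j : Fin 36) :
    ∑ c, entry i c * entry j c = if i = j then 36 else 0 := by
  have h : allPairs (fun i j => popCount (negRows.getD i 0 ^^^ negRows.getD j 0) ==
      if i = j then 0 else 18) = true := by decide +kernel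
  have := allPairs_spec h i j
  rw [beq_iff_eq] at this
  simp only [entry, bitSign_mul, ← Nat.testBit_xor]
  rw [sum_bitSign_testBit, this]
  simp only [Fin.val_inj]
  split_ifs <;> norm_num

theorem sum_col_mul_col (i j : Fin 36) :
    ∑ c, entry c i * entry c j = if i = j then 36 else 0 := by
  have h : allPairs (fun i j => popCount (negCols.getD i 0 ^^^ negCols.getD j 0) ==
      if i = j then 0 else 18) = true := by decide +kernel
  have := allPairs_spec h i j
  rw [beq_iff_eq] at this
  simp only [entry_eq_col, bitSign_mul, ← Nat.testBit_xor]
  rw [sum_bitSign_testBit, this]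
  simp only [Fin.val_inj]
  split_ifs <;> norm_num

/-- Generalized inner product of three rows. -/
def triple (i j k : Fin 36) : ℤ := ∑ c, entry i c * entry j c * entry k c

/-- Generalized inner product of four rows. -/
def quad (i j k l : Fin 36) : ℤ := ∑ c, entry i c * entry j c * entry k c * entry l c

theorem triple_eq (i j k : Fin 36) : triple i j k =
    36 - 2 * (popCount (negRows.getD i 0 ^^^ negRows.getD j 0 ^^^ negRows.getD k 0) : ℤ) := by
  simp only [triple, entry, bitSign_mul, ← Nat.testBit_xor]
  rw [sum_bitSign_testBit]

theorem quad_eq (i j k l : Fin 36) : quad i j k l =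
    36 - 2 * (popCount (negRows.getD i 0 ^^^ negRows.getD j 0 ^^^ negRows.getD k 0 ^^^
      negRows.getD l 0) : ℤ) := by
  simp only [quad, entry, bitSign_mul, ← Nat.testBit_xor]
  rw [sum_bitSign_testBit]

theorem countRows_eq (φ : ℕ → Bool) (m : ℕ) :
    countRows φ m = ∑ l : Fin 36, bif φ (popCount (m ^^^ negRows.getD l 0)) then 1 else 0 := by
  have h : negRows = List.ofFn fun i : Fin 36 => negRows.getD i 0 := by decide +kernel
  rw [countRows, h, List.map_ofFn, List.sum_ofFn, ← h]
  rfl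

theorem quadTable_eq (j k : Fin 36) :
    hexDigit quadTable j k = ∑ l, if (quad 0 j k l).natAbs = 20 then 1 else 0 := by
  have h := allPairs_spec quadTable_spec j k
  rw [beq_iff_eq] at h
  rw [← h, countRows_eq]
  refine Finset.sum_congr rfl fun l _ => ?_
  rw [quad_eq, Bool.cond_eq_ite]
  refine if_congr ?_ rfl rfl
  simp only [Bool.or_eq_true, Nat.beq_eq, Fin.val_zero]
  omega

theorem tripleTable_eq (j k : Fin 36) :
    hexDigit tripleTable j k = ∑ l, if triple j k l = -10 then 1 else 0 := by
  have h := allPairs_spec tripleTable_spec j k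
  rw [beq_iff_eq] at h
  rw [← h, countRows_eq]
  refine Finset.sum_congr rfl fun l _ => ?_
  rw [triple_eq, Bool.cond_eq_ite]
  refine if_congr ?_ rfl rfl
  simp only [Nat.beq_eq]
  omega

/-- A row labelling refined from an invariant labelling by an invariant relation is invariant. -/
theorem refinement_comp {π : Equiv.Perm (Fin 36)} {F : Fin 36 → Fin 36 → ℕ}
    (hF : ∀ j k, F (π j) (π k) = F j k) {w w' : Fin 36 → ℕ} (hw : ∀ j, w (π j) = w j) {p : ℕ}
    (h : ∀ j, (∑ k, F j k * w k ^ 2) % p = w' j) (j : Fin 36) : w' (π j) = w' j := by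
  rw [← h, ← h, ← Equiv.sum_comp π]
  simp only [hF, hw]

theorem triple_perm {π σ : Equiv.Perm (Fin 36)} (h : ∀ i j, entry (π i) (σ j) = entry i j)
    (i j k : Fin 36) : triple (π i) (π j) (π k) = triple i j k := by
  rw [triple, ← Equiv.sum_comp σ]
  simp only [h]
  rfl

theorem quad_perm {π σ : Equiv.Perm (Fin 36)} {r c : Fin 36 → ℤ}
    (hr : ∀ i, r i = 1 ∨ r i = -1) (hc : ∀ i, c i = 1 ∨ c i = -1)
    (h : ∀ i j, r i * entry (π i) (σ j) * c j = entry i j) (i j k l : Fin 36) :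
    (quad (π i) (π j) (π k) (π l)).natAbs = (quad i j k l).natAbs := by
  have e : quad i j k l = r i * r j * r k * r l * quad (π i) (π j) (π k) (π l) := by
    rw [quad, quad, ← Equiv.sum_comp σ fun x =>
      entry (π i) x * entry (π j) x * entry (π k) x * entry (π l) x, Finset.mul_sum]
    refine Finset.sum_congr rfl fun x _ => ?_
    rw [← h i, ← h j, ← h k, ← h l]
    rcases hc x with hx | hx <;> rw [hx] <;> ring
  have a (i) : (r i).natAbs = 1 := by rcases hr i with hi | hi <;> simp [hi]
  simp [e, Int.natAbs_mul, a]

/-- The regular symmetric design has no nontrivial automorphism. -/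
theorem perm_eq_one_of_entry {π σ : Equiv.Perm (Fin 36)}
    (h : ∀ i j, entry (π i) (σ j) = entry i j) : σ = 1 := by
  have hF (j k : Fin 36) :
      hexDigit tripleTable (π j) (π k) = hexDigit tripleTable j k := by
    rw [tripleTable_eq, tripleTable_eq, ← Equiv.sum_comp π]
    simp only [triple_perm h]
  have hA := refinement_comp (F := fun j k => hexDigit tripleTable j k) hF
    (w := fun _ => 1) (w' := fun j => tripleLabelA.getD j 0) (fun _ => rfl) (p := 10007)
    (by decide +kernel)
  have hB := refinement_comp (F := fun j k => hexDigit tripleTable j k) hF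
    (w := fun j => tripleLabelA.getD j 0) hA (w' := fun j => tripleLabelB.getD j 0) (p := 10007)
    (by decide +kernel)
  have hinj : ∀ i j : Fin 36, tripleLabelB.getD i 0 = tripleLabelB.getD j 0 → i = j := by
    decide +kernel
  have hπ (i) : π i = i := hinj _ _ (hB i)
  ext j : 1
  rw [Equiv.Perm.one_apply]
  by_contra hj
  have h1 := sum_col_mul_col (σ j) j
  rw [if_neg hj] at h1
  have h2 := sum_col_mul_col j j
  have h3 (i) : entry i (σ j) = entry i j := by rw [← h i j, hπ]
  simp only [h3] at h1
  rw [h1] at h2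
  simp at h2

theorem row_perm_eq_one {π σ : Equiv.Perm (Fin 36)} {r c : Fin 36 → ℤ}
    (hr : ∀ i, r i = 1 ∨ r i = -1) (hc : ∀ i, c i = 1 ∨ c i = -1)
    (h : ∀ i j, r i * entry (π i) (σ j) * c j = entry i j) (h0 : π 0 = 0) (i : Fin 36) :
    π i = i := by
  have hQ := quad_perm hr hc h
  have hF (j k : Fin 36) : hexDigit quadTable (π j) (π k) = hexDigit quadTable j k := by
    rw [quadTable_eq, quadTable_eq, ← Equiv.sum_comp π]
    have hl (l) := hQ 0 j k l
    rw [h0] at hl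
    simp only [hl]
  have hA := refinement_comp (F := fun j k => hexDigit quadTable j k) hF
    (w := fun _ => 1) (w' := fun j => quadLabelA.getD j 0) (fun _ => rfl) (p := 10007)
    (by decide +kernel)
  have hB := refinement_comp (F := fun j k => hexDigit quadTable j k) hF
    (w := fun j => quadLabelA.getD j 0) hA (w' := fun j => quadLabelB.getD j 0) (p := 10007)
    (by decide +kernel)
  have hC := refinement_comp (F := fun j k => hexDigit quadTable j k) hF
    (w := fun j => quadLabelB.getD j 0) hB (w' := fun j => quadLabelC.getD j 0) (p := 10007)
    (by decide +kernel)
  have fixed : ∀ i : Fin 36, i = 1 ∨ i = 2 ∨ i = 5 →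
      ∀ j : Fin 36, quadLabelC.getD j 0 = quadLabelC.getD i 0 → j = i := by decide +kernel
  have h1 : π 1 = 1 := fixed 1 (by simp) _ (hC 1)
  have h2 : π 2 = 2 := fixed 2 (by simp) _ (hC 2)
  have h5 : π 5 = 5 := fixed 5 (by simp) _ (hC 5)
  have separated : ∀ i j : Fin 36, quadLabelC.getD i 0 = quadLabelC.getD j 0 →
      (quad 0 1 2 i).natAbs = (quad 0 1 2 j).natAbs →
      (quad 0 1 5 i).natAbs = (quad 0 1 5 j).natAbs →
      (quad 0 2 5 i).natAbs = (quad 0 2 5 j).natAbs → i = j := by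
    simp only [quad_eq]
    decide +kernel
  refine separated _ _ (hC i) ?_ ?_ ?_
  · simpa only [h0, h1, h2] using hQ 0 1 2 i
  · simpa only [h0, h1, h5] using hQ 0 1 5 i
  · simpa only [h0, h2, h5] using hQ 0 2 5 i

/-- For every column `l ≠ 0`, some column `j` is such that the entrywise product of the columns
`0, l, j` is not proportional to any column. -/
theorem exists_col_quad_ne {l : Fin 36} (hl : l ≠ 0) : ∃ j, ∀ m,
    (∑ i, entry i 0 * entry i l * entry i j * entry i m).natAbs ≠ 36 := by
  simp only [entry_eq_col, bitSign_mul, ← Nat.testBit_xor, sum_bitSign_testBit]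
  have h : ∀ l : Fin 36, l ≠ 0 → ∀ m : Fin 36, (36 - 2 * (popCount (negCols.getD (0 : Fin 36) 0 ^^^
      negCols.getD l 0 ^^^ negCols.getD (if l = 1 then 2 else 1 : Fin 36) 0 ^^^
        negCols.getD m 0) : ℤ)).natAbs ≠ 36 := by decide +kernel
  exact ⟨_, h l hl⟩

/-- A signed automorphism that fixes the first row up to sign is the identity up to a global
sign. -/
theorem signed_aut_trivial {π σ : Equiv.Perm (Fin 36)} {r c : Fin 36 → ℤ}
    (hr : ∀ i, r i = 1 ∨ r i = -1) (hc : ∀ i, c i = 1 ∨ c i = -1)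
    (h : ∀ i j, r i * entry (π i) (σ j) * c j = entry i j) (h0 : π 0 = 0) :
    (∀ i, π i = i) ∧ (∀ j, σ j = j) ∧ (∀ i, r i = c 0) ∧ ∀ j, c j = c 0 := by
  have hπ := row_perm_eq_one hr hc h h0
  simp only [hπ] at h
  have sq {x : ℤ} (hx : x = 1 ∨ x = -1) : x * x = 1 := by rcases hx with rfl | rfl <;> rfl
  have hr' (i) : r i = c 0 * entry i 0 * entry i (σ 0) := by
    rw [← h i 0]
    linear_combination (-r i) * sq (hc 0) * entry i (σ 0) ^ 2 - r i * sq (entry_eq_or i (σ 0))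
  have hσ0 : σ 0 = 0 := by
    by_contra hne
    obtain ⟨j, hj⟩ := exists_col_quad_ne hne
    refine hj (σ j) ?_
    have e (i) : entry i 0 * entry i (σ 0) * entry i j * entry i (σ j) = c 0 * c j := by
      have h1 := h i j
      rw [hr'] at h1
      rw [← h1]
      linear_combination (c 0 * c j) * (entry i 0 ^ 2 * entry i (σ 0) ^ 2 * sq (entry_eq_or i (σ j))
        + entry i 0 ^ 2 * sq (entry_eq_or i (σ 0)) + sq (entry_eq_or i 0))
    simp only [e]
    rcases hc 0 with h0 | h0 <;> rcases hc j with hj | hj <;> simp [h0, hj]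
  have hr0 (i) : r i = c 0 := by
    rw [hr', hσ0]
    linear_combination c 0 * sq (entry_eq_or i 0)
  have hcol (i j) : c 0 * c j * entry i (σ j) = entry i j := by
    rw [← h i j, hr0]
    ring
  have hσ (j) : σ j = j := by
    by_contra hne
    have h1 := sum_col_mul_col (σ j) j
    have h2 := sum_col_mul_col (σ j) (σ j)
    rw [if_neg hne] at h1
    simp only [← hcol _ j] at h1
    have h3 : c 0 * c j * ∑ i, entry i (σ j) * entry i (σ j) = 0 := by
      rw [← h1, Finset.mul_sum]
      exact Finset.sum_congr rfl fun i _ => by ring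
    rw [h2] at h3
    rcases hc 0 with h0 | h0 <;> rcases hc j with hj | hj <;> simp [h0, hj] at h3
  refine ⟨hπ, hσ, hr0, fun j => ?_⟩
  have h1 := hcol 0 j
  rw [hσ] at h1
  linear_combination (c 0 * entry 0 j) * h1 - c j * sq (hc 0) * entry 0 j ^ 2
    - (c j - c 0) * sq (entry_eq_or 0 j)

section Monomial

variable {L R : Matrix idx idx ℤ}

/-- The monomial matrix whose nonzero entry in row `i` is `r i`, in column `π i`. -/
def signedPerm (π : Equiv.Perm idx) (r : idx → ℤ) : Matrix idx idx ℤ :=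
  Matrix.of fun i j => if j = π i then r i else 0

theorem isMonomialZ_signedPerm (π : Equiv.Perm idx) {r : idx → ℤ}
    (hr : ∀ i, r i = 1 ∨ r i = -1) : IsMonomialZ (signedPerm π r) := by
  have ne (i) : r i ≠ 0 := by rcases hr i with h | h <;> simp [h]
  refine ⟨fun i j => ?_, fun i => ⟨π i, by simp [signedPerm, ne], fun j hj => ?_⟩,
    fun j => ⟨π.symm j, by simp [signedPerm, ne], fun i hi => ?_⟩⟩
  · rw [signedPerm, of_apply]
    split_ifs
    · exact .inr (hr i)
    · exact .inl rfl
  · by_contra h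
    simp [signedPerm, h] at hj
  · by_contra h
    rw [Equiv.eq_symm_apply] at h
    simp [signedPerm, Ne.symm h] at hi

theorem IsMonomialZ.exists_signedPerm (hL : IsMonomialZ L) :
    ∃ (π : Equiv.Perm idx) (r : idx → ℤ), (∀ i, r i = 1 ∨ r i = -1) ∧ L = signedPerm π r := by
  obtain ⟨h1, h2, h3⟩ := hL
  choose f hf hf' using h2
  choose g hg hg' using h3
  refine ⟨⟨f, g, fun i => (hg' _ _ (hf i)).symm, fun j => (hf' _ _ (hg j)).symm⟩,
    fun i => L i (f i), fun i => (h1 i (f i)).resolve_left (hf i), ?_⟩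
  ext i j
  simp only [signedPerm, of_apply, Equiv.coe_fn_mk]
  split_ifs with h
  · rw [h]
  · by_contra hne
    exact h (hf' _ _ hne)

theorem IsMonomialZ.transpose (hL : IsMonomialZ L) : IsMonomialZ Lᵀ :=
  ⟨fun i j => hL.1 j i, hL.2.2, hL.2.1⟩

theorem IsMonomialZ.neg (hL : IsMonomialZ L) : IsMonomialZ (-L) := by
  refine ⟨fun i j => ?_, by simpa using hL.2.1, by simpa using hL.2.2⟩
  rcases hL.1 i j with h | h | h <;> simp [h]

theorem isMonomialZ_one : IsMonomialZ 1 := by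
  convert isMonomialZ_signedPerm 1 (r := fun _ => 1) (fun _ => .inl rfl)
  ext i j
  simp [signedPerm, Matrix.one_apply, eq_comm]

theorem signedPerm_mul (π : Equiv.Perm idx) (r : idx → ℤ) (M : Matrix idx idx ℤ) (i j : idx) :
    (signedPerm π r * M) i j = r i * M (π i) j := by
  simp [Matrix.mul_apply, signedPerm]

theorem mul_signedPerm_transpose (σ : Equiv.Perm idx) (c : idx → ℤ) (M : Matrix idx idx ℤ)
    (i j : idx) : (M * (signedPerm σ c)ᵀ) i j = M i (σ j) * c j := by
  simp [Matrix.mul_apply, signedPerm]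

theorem signedPerm_mul_mul (π σ : Equiv.Perm idx) (r c : idx → ℤ) (M : Matrix idx idx ℤ)
    (i j : idx) :
    (signedPerm π r * M * (signedPerm σ c)ᵀ) i j = r i * M (π i) (σ j) * c j := by
  rw [mul_signedPerm_transpose, signedPerm_mul]

theorem IsMonomialZ.mul (hL : IsMonomialZ L) (hR : IsMonomialZ R) : IsMonomialZ (L * R) := by
  obtain ⟨π, r, hr, rfl⟩ := hL.exists_signedPerm
  obtain ⟨σ, c, hc, rfl⟩ := hR.exists_signedPerm
  convert isMonomialZ_signedPerm (σ * π) (r := fun i => r i * c (π i)) fun i => ?_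
  · ext i j
    rw [signedPerm_mul]
    simp only [signedPerm, of_apply, Equiv.Perm.mul_apply, mul_ite, mul_zero]
    exact if_congr .rfl rfl rfl
  · rcases hr i with h | h <;> rcases hc (π i) with h' | h' <;> simp [h, h']

theorem IsMonomialZ.mul_transpose (hL : IsMonomialZ L) : L * Lᵀ = 1 := by
  obtain ⟨π, r, hr, rfl⟩ := hL.exists_signedPerm
  ext i j
  rw [signedPerm_mul]
  rcases hr i with h | h <;> simp [signedPerm, Matrix.one_apply, h]
  all_goals
    split_ifs with hij
    · subst hij
      simp [h]
    · rfl

theorem IsMonomialZ.transpose_mul (hL : IsMonomialZ L) : Lᵀ * L = 1 :=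
  mul_eq_one_comm.mp hL.mul_transpose

/-- The set of signed automorphisms of `M`. -/
def autSet (M : Matrix idx idx ℤ) : Set (Matrix idx idx ℤ × Matrix idx idx ℤ) :=
  {p | IsMonomialZ p.1 ∧ IsMonomialZ p.2 ∧ p.1 * M * p.2 = M}

variable {M : Matrix idx idx ℤ} {p q : Matrix idx idx ℤ × Matrix idx idx ℤ}

theorem autSet_mul (hp : p ∈ autSet M) (hq : q ∈ autSet M) : (p.1 * q.1, q.2 * p.2) ∈ autSet M := by
  refine ⟨hp.1.mul hq.1, hq.2.1.mul hp.2.1, ?_⟩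
  calc p.1 * q.1 * M * (q.2 * p.2) = p.1 * (q.1 * M * q.2) * p.2 := by simp only [Matrix.mul_assoc]
    _ = M := by rw [hq.2.2, hp.2.2]

theorem autSet_transpose (hp : p ∈ autSet M) : (p.1ᵀ, p.2ᵀ) ∈ autSet M := by
  refine ⟨hp.1.transpose, hp.2.1.transpose, ?_⟩
  calc p.1ᵀ * M * p.2ᵀ = p.1ᵀ * (p.1 * M * p.2) * p.2ᵀ := by rw [hp.2.2]
    _ = (p.1ᵀ * p.1) * M * (p.2 * p.2ᵀ) := by simp only [Matrix.mul_assoc]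
    _ = M := by rw [hp.1.transpose_mul, hp.2.1.mul_transpose, Matrix.one_mul, Matrix.mul_one]

theorem autSet_neg (hp : p ∈ autSet M) : (-p.1, -p.2) ∈ autSet M :=
  ⟨hp.1.neg, hp.2.1.neg, by simpa using hp.2.2⟩

/-- If the signed automorphisms act transitively on the rows, with stabilizer `{1, -1}` of some
row, there are twice as many of them as rows. -/
theorem ncard_autSet {o : idx} (htrans : ∀ b, ∃ p ∈ autSet M, p.1 b o ≠ 0)
    (hstab : ∀ p ∈ autSet M, p.1 o o ≠ 0 → p = (1, 1) ∨ p = (-1, -1)) :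
    (autSet M).ncard = 72 := by
  choose g hg hgo using htrans
  let f : idx × Bool → Matrix idx idx ℤ × Matrix idx idx ℤ := fun x =>
    bif x.2 then (-(g x.1).1ᵀ, -(g x.1).2ᵀ) else ((g x.1).1ᵀ, (g x.1).2ᵀ)
  have hf : Function.Injective f := by
    have key (x) : (f x).1 = bif x.2 then -(g x.1).1ᵀ else (g x.1).1ᵀ := by
      rcases x with ⟨b, _ | _⟩ <;> rfl
    intro x y hxy
    have h1 : (f x).1 = (f y).1 := by rw [hxy]
    rw [key, key] at h1
    have hb : x.1 = y.1 := by
      obtain ⟨j, hj, hj'⟩ := (hg y.1).1.2.2 o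
      have h2 := hj' y.1 (hgo y.1)
      rw [h2]
      refine hj' x.1 fun h0 => hgo x.1 ?_
      have h3 := congrFun (congrFun h1 o) x.1
      rcases x with ⟨b, _ | _⟩ <;> rcases y with ⟨b', _ | _⟩ <;>
        simp at h0 h3 ⊢ <;> simpa [h0] using h3
    have h3 := congrFun (congrFun h1 o) x.1
    have h4 := hgo x.1
    rcases x with ⟨b, _ | _⟩ <;> rcases y with ⟨b', _ | _⟩ <;> simp only at hb <;> subst hb <;>
      simp at h3 h4 ⊢ <;> omega
  have hrange : autSet M = Set.range f := by
    ext p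
    constructor
    · intro hp
      obtain ⟨b, hb, -⟩ := hp.1.2.1 o
      have hpq := autSet_mul hp (hg b)
      have hne : (p.1 * (g b).1) o o ≠ 0 := by
        obtain ⟨π, r, hr, hπ⟩ := hp.1.exists_signedPerm
        have hbo : b = π o := by
          by_contra h
          exact hb (by simp [hπ, signedPerm, h])
        rw [hπ, signedPerm_mul, ← hbo]
        refine mul_ne_zero ?_ (hgo b)
        rcases hr o with h | h <;> simp [h]
      have e1 : p.1 = p.1 * (g b).1 * (g b).1ᵀ := by
        rw [Matrix.mul_assoc, (hg b).1.mul_transpose, Matrix.mul_one]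
      have e2 : p.2 = (g b).2ᵀ * ((g b).2 * p.2) := by
        rw [← Matrix.mul_assoc, (hg b).2.1.transpose_mul, Matrix.one_mul]
      rcases hstab _ hpq hne with h | h <;> rw [Prod.mk.injEq] at h
      · refine ⟨(b, false), ?_⟩
        rw [h.1, Matrix.one_mul] at e1
        rw [h.2, Matrix.mul_one] at e2
        exact (Prod.ext e1 e2).symm
      · refine ⟨(b, true), ?_⟩
        rw [h.1, Matrix.neg_mul, Matrix.one_mul] at e1
        rw [h.2, Matrix.mul_neg, Matrix.mul_one] at e2
        exact (Prod.ext e1 e2).symm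
    · rintro ⟨⟨b, _ | _⟩, rfl⟩
      · exact autSet_transpose (hg b)
      · exact autSet_neg (autSet_transpose (hg b))
  rw [hrange, ← Set.image_univ, Set.ncard_image_of_injective _ hf, Set.ncard_univ,
    Nat.card_eq_fintype_card]
  simp [ZMod.card]

end Monomial

section Pless

/-- The affine permutations of `GF(17)` with a square multiplier, fixing `∞`. -/
def affinePerm (t : ZMod 17) (k : Fin 8) : Equiv.Perm (Option (ZMod 17)) :=
  Equiv.optionCongr ((Equiv.mulLeft₀ (((k.1 + 1 : ℕ) : ZMod 17) ^ 2)
    (by revert k; decide)).trans (Equiv.addRight t))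

theorem Umat_affinePerm (t : ZMod 17) (k : Fin 8) (i j : Option (ZMod 17)) :
    Umat (ZMod 17) (affinePerm t k i) (affinePerm t k j) = Umat (ZMod 17) i j := by
  have hk : ((k.1 + 1 : ℕ) : ZMod 17) ≠ 0 := by revert k; decide
  rcases i with _ | a <;> rcases j with _ | b <;> try rfl
  simp only [affinePerm, Umat, Smat, Equiv.optionCongr_apply, Option.map_some, Equiv.trans_apply,
    Equiv.mulLeft₀_apply, Equiv.coe_addRight, add_sub_add_right_eq_sub]
  rw [← mul_sub, map_mul, quadraticChar_sq_one' hk, one_mul]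

theorem affinePerm_injective :
    Function.Injective fun x : ZMod 17 × Fin 8 => affinePerm x.1 x.2 := by
  rintro ⟨t, k⟩ ⟨t', k'⟩ h
  have h0 := DFunLike.congr_fun h (some 0)
  have h1 := DFunLike.congr_fun h (some 1)
  simp [affinePerm] at h0 h1
  subst h0
  have hk : ∀ k k' : Fin 8, ((k.1 : ZMod 17) + 1) ^ 2 = ((k'.1 : ZMod 17) + 1) ^ 2 → k = k' := by
    decide
  rw [hk k k' (by simpa using h1)]

theorem mem_autSet_Hmat (t : ZMod 17) (k : Fin 8) :
    (signedPerm (Equiv.sumCongr (affinePerm t k) (affinePerm t k)) (fun _ => 1),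
      (signedPerm (Equiv.sumCongr (affinePerm t k) (affinePerm t k)) (fun _ => 1))ᵀ) ∈
      autSet (Hmat (ZMod 17)) := by
  have hm := isMonomialZ_signedPerm (Equiv.sumCongr (affinePerm t k) (affinePerm t k))
    (r := fun _ => 1) (fun _ => .inl rfl)
  refine ⟨hm, hm.transpose, ?_⟩
  ext i j
  rw [signedPerm_mul_mul]
  rcases i with i | i <;> rcases j with j | j <;>
    simp [Hmat, Umat_affinePerm, Matrix.one_apply]

/-- The matrix `H` has more than 72 signed automorphisms. -/
theorem not_hadEquiv_Hmat {M : Matrix idx idx ℤ} (hM : (autSet M).ncard = 72) :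
    ¬ HadEquiv M (Hmat (ZMod 17)) := by
  rintro ⟨L, R, hL, hR, h⟩
  let P : ZMod 17 × Fin 8 → Matrix idx idx ℤ := fun x =>
    signedPerm (Equiv.sumCongr (affinePerm x.1 x.2) (affinePerm x.1 x.2)) (fun _ => 1)
  have hP (x) : (P x, (P x)ᵀ) ∈ autSet (Hmat (ZMod 17)) := mem_autSet_Hmat x.1 x.2
  let f : ZMod 17 × Fin 8 → Matrix idx idx ℤ × Matrix idx idx ℤ := fun x =>
    (Lᵀ * P x * L, R * (P x)ᵀ * Rᵀ)
  have hf (x) : f x ∈ autSet M := by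
    refine ⟨(hL.transpose.mul (hP x).1).mul hL, (hR.mul (hP x).2.1).mul hR.transpose, ?_⟩
    calc Lᵀ * P x * L * M * (R * (P x)ᵀ * Rᵀ)
        = Lᵀ * (P x * (L * M * R) * (P x)ᵀ) * Rᵀ := by simp only [Matrix.mul_assoc]
      _ = Lᵀ * (L * M * R) * Rᵀ := by rw [h, (hP x).2.2]
      _ = Lᵀ * L * M * (R * Rᵀ) := by simp only [Matrix.mul_assoc]
      _ = M := by rw [hL.transpose_mul, hR.mul_transpose, Matrix.one_mul, Matrix.mul_one]
  have hinj : Function.Injective f := by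
    intro x y hxy
    have h1 : Lᵀ * P x * L = Lᵀ * P y * L := congrArg Prod.fst hxy
    have h2 (x) : P x = L * (Lᵀ * P x * L) * Lᵀ := by
      calc P x = L * Lᵀ * P x * (L * Lᵀ) := by
            rw [hL.mul_transpose, Matrix.one_mul, Matrix.mul_one]
        _ = _ := by simp only [Matrix.mul_assoc]
    have h3 : P x = P y := by rw [h2, h1, ← h2]
    refine affinePerm_injective (Equiv.ext fun a => ?_)
    have h4 := congrFun (congrFun h3 (.inl a)) (.inl (affinePerm x.1 x.2 a))
    by_contra hne
    simp [P, signedPerm, hne] at h4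
  have hfin : (autSet M).Finite := Set.finite_of_ncard_ne_zero (by rw [hM]; norm_num)
  have hle := Set.ncard_le_ncard (Set.range_subset_iff.mpr hf) hfin
  rw [hM, ← Set.image_univ, Set.ncard_image_of_injective _ hinj, Set.ncard_univ,
    Nat.card_eq_fintype_card] at hle
  simp [ZMod.card] at hle

end Pless

/-- The numbering of the rows and columns of the matrix. -/
def idxEquiv : idx ≃ Fin 36 :=
  (Equiv.sumCongr (finSuccEquivLast (n := 17)).symm (finSuccEquivLast (n := 17)).symm).trans
    (finSumFinEquiv (m := 18) (n := 18))

/-- The regular Hadamard matrix. -/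
def regularMat : Matrix idx idx ℤ := fun i j => entry (idxEquiv i) (idxEquiv j)

theorem regularMat_eq_or (i j : idx) : regularMat i j = 1 ∨ regularMat i j = -1 :=
  entry_eq_or _ _

theorem isHadamard36_regularMat : IsHadamard36 regularMat := by
  refine ⟨regularMat_eq_or, ?_⟩
  ext i j
  have h := sum_row_mul_row (idxEquiv i) (idxEquiv j)
  rw [← Equiv.sum_comp idxEquiv] at h
  simp only [EmbeddingLike.apply_eq_iff_eq] at h
  simp only [Matrix.mul_apply, Matrix.transpose_apply, regularMat, Matrix.smul_apply,
    Matrix.one_apply, smul_eq_mul, mul_ite, mul_one, mul_zero]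
  exact h.trans (if_congr .rfl rfl rfl)

theorem card_row_eq_one (i : idx) : (univ.filter fun j => regularMat i j = 1).card = 15 := by
  have h := sum_row (idxEquiv i)
  rw [← Equiv.sum_comp idxEquiv] at h
  have e (j) : (2 * (if regularMat i j = 1 then 1 else 0) : ℤ) = 1 + regularMat i j := by
    rcases regularMat_eq_or i j with h | h <;> simp [h]
  have h2 : (2 * (univ.filter fun j => regularMat i j = 1).card : ℤ) = 30 := by
    rw [Finset.card_filter, Nat.cast_sum, Finset.mul_sum]
    push_cast
    simp only [e, Finset.sum_add_distrib]
    rw [show ∑ j, regularMat i j = -6 from h]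
    simp [ZMod.card]
  omega

theorem card_col_inter {j k : idx} (hjk : j ≠ k) :
    (univ.filter fun i => regularMat i j = 1 ∧ regularMat i k = 1).card = 6 := by
  have hj := sum_col (idxEquiv j)
  have hk := sum_col (idxEquiv k)
  have h := sum_col_mul_col (idxEquiv j) (idxEquiv k)
  rw [if_neg (by simpa using hjk)] at h
  rw [← Equiv.sum_comp idxEquiv] at hj hk h
  have e (i) : (4 * (if regularMat i j = 1 ∧ regularMat i k = 1 then 1 else 0) : ℤ) =
      1 + regularMat i j + regularMat i k + regularMat i j * regularMat i k := by
    rcases regularMat_eq_or i j with h | h <;> rcases regularMat_eq_or i k with h' | h' <;>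
      simp [h, h']
  have h2 : (4 * (univ.filter fun i => regularMat i j = 1 ∧ regularMat i k = 1).card : ℤ) = 24 := by
    rw [Finset.card_filter, Nat.cast_sum, Finset.mul_sum]
    push_cast
    simp only [e, Finset.sum_add_distrib]
    rw [show ∑ i, regularMat i j = -6 from hj, show ∑ i, regularMat i k = -6 from hk,
      show ∑ i, regularMat i j * regularMat i k = 0 from h]
    simp [ZMod.card]
  omega

theorem perm_eq_one_of_regularMat {σ : Equiv.Perm idx}
    (h : ∀ i, ∃ i', ∀ j, regularMat i (σ j) = regularMat i' j) : σ = 1 := by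
  choose τ hτ using h
  have hinj : Function.Injective τ := by
    intro i k hik
    by_contra hne
    have h1 := sum_row_mul_row (idxEquiv i) (idxEquiv k)
    have h2 := sum_row_mul_row (idxEquiv k) (idxEquiv k)
    rw [if_neg (by simpa using hne)] at h1
    have e (c) : entry (idxEquiv i) c = entry (idxEquiv k) c := by
      have := (hτ i (σ.symm (idxEquiv.symm c))).trans (by rw [hik, ← hτ k])
      simpa [regularMat] using this
    simp only [e] at h1
    rw [h1] at h2
    simp at h2
  let τ' : Equiv.Perm idx := Equiv.ofBijective τ (Finite.injective_iff_bijective.mp hinj)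
  have h1 : idxEquiv.permCongr σ = 1 := by
    refine perm_eq_one_of_entry (π := idxEquiv.permCongr τ'⁻¹) fun i j => ?_
    have h2 := hτ (τ'⁻¹ (idxEquiv.symm i)) (idxEquiv.symm j)
    have h3 : τ (τ'⁻¹ (idxEquiv.symm i)) = idxEquiv.symm i := τ'.apply_symm_apply _
    rw [h3] at h2
    simpa [regularMat, Equiv.permCongr_apply] using h2
  ext j : 1
  have h2 := DFunLike.congr_fun h1 (idxEquiv j)
  simpa [Equiv.permCongr_apply] using h2

theorem stabilizer_autSet_regularMat {p : Matrix idx idx ℤ × Matrix idx idx ℤ}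
    (hp : p ∈ autSet regularMat) (h0 : p.1 (idxEquiv.symm 0) (idxEquiv.symm 0) ≠ 0) :
    p = (1, 1) ∨ p = (-1, -1) := by
  obtain ⟨L, R⟩ := p
  obtain ⟨hL, hR, h⟩ := hp
  obtain ⟨π, r, hr, rfl⟩ := hL.exists_signedPerm
  obtain ⟨σ, c, hc, hRt⟩ := hR.transpose.exists_signedPerm
  obtain rfl : R = (signedPerm σ c)ᵀ := by rw [← hRt, Matrix.transpose_transpose]
  have h1 (i j) : r i * regularMat (π i) (σ j) * c j = regularMat i j := by
    rw [← signedPerm_mul_mul]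
    exact congrFun (congrFun h i) j
  have h2 : π (idxEquiv.symm 0) = idxEquiv.symm 0 := by
    by_contra hne
    exact h0 (by simp [signedPerm, Ne.symm hne])
  obtain ⟨hπ, hσ, hr', hc'⟩ := signed_aut_trivial (π := idxEquiv.permCongr π)
    (σ := idxEquiv.permCongr σ) (r := fun i => r (idxEquiv.symm i))
    (c := fun i => c (idxEquiv.symm i)) (fun _ => hr _) (fun _ => hc _)
    (fun i j => by
      simpa [regularMat, Equiv.permCongr_apply] using h1 (idxEquiv.symm i) (idxEquiv.symm j))
    (by simp [Equiv.permCongr_apply, h2])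
  have hπ1 : π = 1 := Equiv.ext fun i => by
    simpa [Equiv.permCongr_apply] using hπ (idxEquiv i)
  have hσ1 : σ = 1 := Equiv.ext fun i => by
    simpa [Equiv.permCongr_apply] using hσ (idxEquiv i)
  have hr1 : r = fun _ => c (idxEquiv.symm 0) := funext fun i => by
    simpa using hr' (idxEquiv i)
  have hc1 : c = fun _ => c (idxEquiv.symm 0) := funext fun i => by
    simpa using hc' (idxEquiv i)
  have e1 : signedPerm 1 (fun _ => 1) = 1 := by
    ext i j
    simp [signedPerm, Matrix.one_apply, eq_comm]
  have e2 : signedPerm 1 (fun _ => -1) = -1 := by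
    ext i j
    rw [Matrix.neg_apply, ← e1]
    simp only [signedPerm, of_apply]
    split_ifs <;> rfl
  rw [hπ1, hσ1, hr1, hc1]
  rcases hc (idxEquiv.symm 0) with h | h
  · left
    rw [h, e1, Matrix.transpose_one]
  · right
    rw [h, e2, Matrix.transpose_neg, Matrix.transpose_one]

/-- The permutation of `Fin 36` with a given list of values. -/
noncomputable def listPerm (l : List ℕ)
    (h : Function.Injective fun i : Fin 36 => Fin.ofNat 36 (l.getD i 0)) : Equiv.Perm (Fin 36) :=
  Equiv.ofBijective _ (Finite.injective_iff_bijective.mp h)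

/-- Row `b` can be mapped to row `0` by a signed automorphism. -/
def Reach (b : Fin 36) : Prop :=
  ∃ p ∈ autSet regularMat, p.1 (idxEquiv.symm b) (idxEquiv.symm 0) ≠ 0

theorem Reach.of_perm {π σ : Equiv.Perm (Fin 36)} {r c : ℕ}
    (h : ∀ i j : Fin 36, bitSign (r.testBit i) * entry (π i) (σ j) *
      bitSign (c.testBit j) = entry i j)
    {b : Fin 36} (hb : Reach (π b)) : Reach b := by
  obtain ⟨q, hq, hq0⟩ := hb
  let L := signedPerm (idxEquiv.symm.permCongr π) fun i => bitSign (r.testBit (idxEquiv i))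
  let R := signedPerm (idxEquiv.symm.permCongr σ) fun i => bitSign (c.testBit (idxEquiv i))
  have hg : (L, Rᵀ) ∈ autSet regularMat := by
    refine ⟨isMonomialZ_signedPerm _ fun _ => bitSign_eq _,
      (isMonomialZ_signedPerm _ fun _ => bitSign_eq _).transpose, ?_⟩
    ext i j
    rw [signedPerm_mul_mul]
    simpa [regularMat, Equiv.permCongr_apply] using h (idxEquiv i) (idxEquiv j)
  refine ⟨_, autSet_mul hg hq, ?_⟩
  change (L * q.1) _ _ ≠ 0
  rw [signedPerm_mul]
  refine mul_ne_zero ?_ (by simpa [Equiv.permCongr_apply] using hq0)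
  rcases bitSign_eq (r.testBit (idxEquiv (idxEquiv.symm b))) with h | h <;> rw [h] <;> norm_num

theorem reach_of_rotation {n : ℕ} (hn : n < 17) (h : Reach ⟨n, by omega⟩) :
    Reach ⟨n + 1, by omega⟩ := by
  have hr : ∀ i : Fin 36, i ≠ 0 → i.1 < 18 →
    (listPerm rotRow (by decide +kernel) i).1 + 1 = i.1 := by decide +kernel
  refine Reach.of_perm (π := listPerm rotRow (by decide +kernel))
    (σ := listPerm rotCol (by decide +kernel)) (r := rotRowNeg) (c := rotColNeg)
    (by decide +kernel) ?_
  convert h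
  simpa using hr ⟨n + 1, by omega⟩ (by simp [Fin.ext_iff]) (show n + 1 < 18 by omega)

theorem reach_of_reflection {n : ℕ} (hn : n < 18) (h : Reach ⟨n, by omega⟩) :
    Reach ⟨18 + n, by omega⟩ := by
  have hr : ∀ i : Fin 36, 18 ≤ i.1 →
    18 + (listPerm swpRow (by decide +kernel) i).1 = i.1 := by decide +kernel
  refine Reach.of_perm (π := listPerm swpRow (by decide +kernel))
    (σ := listPerm swpCol (by decide +kernel)) (r := swpRowNeg) (c := swpColNeg)
    (by decide +kernel) ?_
  convert h
  simpa using hr ⟨18 + n, by omega⟩ (by simp)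

theorem reach (b : Fin 36) : Reach b := by
  have h : ∀ n, ∀ hn : n < 18, Reach ⟨n, by omega⟩ := by
    intro n
    induction n with
    | zero =>
      exact fun _ => ⟨(1, 1), ⟨isMonomialZ_one, isMonomialZ_one, by simp⟩, by
        simp [Matrix.one_apply]⟩
    | succ n ih => exact fun hn => reach_of_rotation (by omega) (ih (by omega))
  by_cases hb : b.1 < 18
  · exact h b hb
  · have h1 := reach_of_reflection (n := b.1 - 18) (by omega) (h _ (by omega))
    convert h1
    omega

theorem ncard_autSet_regularMat : (autSet regularMat).ncard = 72 := by
  refine ncard_autSet (o := idxEquiv.symm 0) (fun b => ?_)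
    fun _ => stabilizer_autSet_regularMat
  simpa [Reach] using reach (idxEquiv b)

/-- The quadratic character of `GF(17)`. -/
def chiTable : List ℤ := [0, 1, 1, -1, 1, -1, -1, -1, 1, 1, -1, -1, -1, 1, -1, 1, 1]

/-- Integer representatives of the entries of the generator matrix of the code. -/
def genEntry (k : Fin 18) (j : Fin 36) : ℤ :=
  if j.1 < 18 then if k.1 = j.1 then 1 else 0
  else if k.1 = 17 then if j.1 = 35 then 0 else 1
  else if j.1 = 35 then -1
  else chiTable.getD ((k.1 + 35 - j.1) % 17) 0

theorem genRowL_apply (k : Fin 18) (j : Fin 36) :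
    genRowL (ZMod 17) (finSuccEquivLast (n := 17) k) (idxEquiv.symm j) =
      (genEntry k j : ZMod 3) := by
  revert k j
  decide +kernel

theorem row_eq_sum (i : Fin 36) : (fun j => ((regularMat (idxEquiv.symm i) j : ℤ) : ZMod 3)) =
    ∑ k : Fin 18, (entry i (Fin.castAdd 18 k) : ZMod 3) •
      genRowL (ZMod 17) (finSuccEquivLast (n := 17) k) := by
  have h : ∀ i j : Fin 36,
      (entry i j - ∑ k : Fin 18, entry i (Fin.castAdd 18 k) * genEntry k j) % 3 = 0 := by
    decide +kernel
  funext j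
  obtain ⟨j, rfl⟩ := idxEquiv.symm.surjective j
  have h1 := (ZMod.intCast_zmod_eq_zero_iff_dvd _ 3).mpr (Int.dvd_of_emod_eq_zero (h i j))
  push_cast at h1
  simpa [regularMat, genRowL_apply] using sub_eq_zero.mp h1

theorem genRowL_eq_sum (k : Fin 18) : genRowL (ZMod 17) (finSuccEquivLast (n := 17) k) =
    ∑ i : Fin 18, (hexDigit leftInvTable k i : ZMod 3) •
      (fun j => ((regularMat (idxEquiv.symm (Fin.castAdd 18 i)) j : ℤ) : ZMod 3)) := by
  have h : ∀ (k : Fin 18) (j : Fin 36), (genEntry k j -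
      ∑ i : Fin 18, (hexDigit leftInvTable k i : ℤ) * entry (Fin.castAdd 18 i) j) % 3 = 0 := by
    decide +kernel
  funext j
  obtain ⟨j, rfl⟩ := idxEquiv.symm.surjective j
  have h1 := (ZMod.intCast_zmod_eq_zero_iff_dvd _ 3).mpr (Int.dvd_of_emod_eq_zero (h k j))
  push_cast at h1
  simpa [regularMat, genRowL_apply] using sub_eq_zero.mp h1

theorem row_mem_Lcode (i : idx) :
    (fun j => ((regularMat i j : ℤ) : ZMod 3)) ∈ Lcode (ZMod 17) := by
  obtain ⟨i, rfl⟩ := idxEquiv.symm.surjective i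
  rw [row_eq_sum]
  exact Submodule.sum_mem _ fun k _ => Submodule.smul_mem _ _ (Submodule.subset_span ⟨_, rfl⟩)

theorem span_rows_eq_Lcode : Submodule.span (ZMod 3)
    (Set.range fun i => fun j => ((regularMat i j : ℤ) : ZMod 3)) = Lcode (ZMod 17) := by
  refine le_antisymm (Submodule.span_le.mpr (Set.range_subset_iff.mpr row_mem_Lcode))
    (Submodule.span_le.mpr (Set.range_subset_iff.mpr fun k => ?_))
  obtain ⟨k, rfl⟩ := (finSuccEquivLast (n := 17)).surjective k
  rw [genRowL_eq_sum]
  exact Submodule.sum_mem _ fun i _ => Submodule.smul_mem _ _ (Submodule.subset_span ⟨_, rfl⟩)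

/-- (Theorem 3(i), existence) There is a Hadamard matrix `H'` of order 36 all of whose
rows (mod 3) lie in `L(17)`, each row having exactly 15 entries `+1` (so `H'` is regular),
`H'` not equivalent to the Paley-type matrix `H`, with full automorphism group of order 72,
whose rows (mod 3) span `L(17)` (3-rank 18), and such that `(H' + J)/2` is the incidence
matrix of a symmetric 2-(36,15,6) design whose only automorphism is the identity. -/
theorem stmt_12 :
    ∃ H' : Matrix idx idx ℤ,
      IsHadamard36 H' ∧
      -- every row of H', reduced mod 3, is a codeword of L(17)
      (∀ i, (fun j => ((H' i j : ℤ) : ZMod 3)) ∈ Lcode (ZMod 17)) ∧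
      -- H' is regular: every row has exactly 15 entries +1
      (∀ i, (Finset.univ.filter (fun j => H' i j = 1)).card = 15) ∧
      -- H' is not equivalent to the Paley-type Hadamard matrix H
      ¬ HadEquiv H' (Hmat (ZMod 17)) ∧
      -- the full automorphism group of H' has order 72
      Set.ncard {p : Matrix idx idx ℤ × Matrix idx idx ℤ |
        IsMonomialZ p.1 ∧ IsMonomialZ p.2 ∧ p.1 * H' * p.2 = H'} = 72 ∧
      -- the rows of H' (mod 3) span L(17), i.e. H' has 3-rank 18
      Submodule.span (ZMod 3)
        (Set.range (fun i => fun j => ((H' i j : ℤ) : ZMod 3))) = Lcode (ZMod 17) ∧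
      -- N = (H' + J)/2 is the incidence matrix of a symmetric 2-(36,15,6) design:
      -- every two distinct columns have exactly 6 common +1 entries
      (∀ j₁ j₂ : idx, j₁ ≠ j₂ →
        (Finset.univ.filter (fun i => H' i j₁ = 1 ∧ H' i j₂ = 1)).card = 6) ∧
      -- ... whose only automorphism is the identity
      (∀ σ : Equiv.Perm idx, (∀ i, ∃ i', ∀ j, H' i (σ j) = H' i' j) → σ = 1) := by
  exact ⟨regularMat, isHadamard36_regularMat, row_mem_Lcode, card_row_eq_one,
    not_hadEquiv_Hmat ncard_autSet_regularMat, ncard_autSet_regularMat, span_rows_eq_Lcode,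
    fun _ _ => card_col_inter, fun _ => perm_eq_one_of_regularMat⟩
end
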